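/- arXiv:2409.05194 — 5 statements merged into one kernel-verified Lean document; each statement's English description precedes it below -/
import Mathlib

section
/- Let τ be an equicontinuous Köthe topology on E_K induced by F, and let φ : E_K → (-∞, ∞] be a convex and proper function. Then the following are equivalent: (1) for every λ ∈ ℝ and every ε > 0 the set {f ∈ E_K : φ(f) ≤ λ} ∩ εK is τ-closed; (2) φ has the equicontinuous Fatou property. -/
open MeasureTheory Filter Topology Pointwise

noncomputable section

namespace EquicontKothe

variable {Ω : Type*} [MeasurableSpace Ω] (μ : Measure Ω) [IsProbabilityMeasure μ]

/-- Convergence in probability of a sequence in `L⁰(μ)`. -/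
def TendstoInProb (f : ℕ → Ω →ₘ[μ] ℝ) (g : Ω →ₘ[μ] ℝ) : Prop :=
  TendstoInMeasure μ (fun n => ⇑(f n)) atTop ⇑g

/-- A set of elements of `L⁰(μ)` is closed in probability (stated sequentially, which is
equivalent since the topology of convergence in probability is metrizable). -/
def ClosedInProb (C : Set (Ω →ₘ[μ] ℝ)) : Prop :=
  ∀ f : ℕ → Ω →ₘ[μ] ℝ, (∀ n, f n ∈ C) → ∀ g : Ω →ₘ[μ] ℝ, TendstoInProb μ f g → g ∈ C

/-- Boundedness in probability. -/
def BoundedInProb (C : Set (Ω →ₘ[μ] ℝ)) : Prop :=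
  ∀ ε : ℝ, 0 < ε → ∃ δ : ℝ, 0 < δ ∧ ∀ f ∈ C, μ {ω | δ ≤ |f ω|} ≤ ENNReal.ofReal ε

/-- The polar of a set `C ⊆ L⁰(μ)`. -/
def polar (C : Set (Ω →ₘ[μ] ℝ)) : Set (Ω →ₘ[μ] ℝ) :=
  {g | ∀ f ∈ C, ∫⁻ ω, (‖f ω * g ω‖₊ : ENNReal) ∂μ ≤ 1}

/-- `E_K`, the span of `K`. -/
def EK (K : Set (Ω →ₘ[μ] ℝ)) : Submodule ℝ (Ω →ₘ[μ] ℝ) := Submodule.span ℝ K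

/-- `E'_K`, the span of the polar of `K`. -/
def EK' (K : Set (Ω →ₘ[μ] ℝ)) : Submodule ℝ (Ω →ₘ[μ] ℝ) := Submodule.span ℝ (polar μ K)

/-- The pairing `(f, g) ↦ ∫ fg dμ`. -/
def pair (f g : Ω →ₘ[μ] ℝ) : ℝ := ∫ ω, f ω * g ω ∂μ

/-- A set `F ⊆ L⁰(μ)` is solid. -/
def SolidSet (F : Set (Ω →ₘ[μ] ℝ)) : Prop :=
  ∀ g ∈ F, ∀ h : Ω →ₘ[μ] ℝ, (∀ᵐ ω ∂μ, |h ω| ≤ |g ω|) → h ∈ F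

/-- A set `F ⊆ L⁰(μ)` is a linear subspace. -/
def IsSubspace (F : Set (Ω →ₘ[μ] ℝ)) : Prop :=
  (0 : Ω →ₘ[μ] ℝ) ∈ F ∧ (∀ g ∈ F, ∀ h ∈ F, g + h ∈ F) ∧
    ∀ (a : ℝ) (g : Ω →ₘ[μ] ℝ), g ∈ F → a • g ∈ F

/-- `g` is strictly positive, i.e. `g > 0` a.e. -/
def StrictlyPos (g : Ω →ₘ[μ] ℝ) : Prop := ∀ᵐ ω ∂μ, 0 < g ω

/-- `F` separates the points of the subspace `E` via the pairing `(f,g) ↦ ∫ fg dμ`. -/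
def Separates (F : Set (Ω →ₘ[μ] ℝ)) (E : Submodule ℝ (Ω →ₘ[μ] ℝ)) : Prop :=
  ∀ f ∈ E, f ≠ 0 → ∃ g ∈ F, pair μ f g ≠ 0

/-- The weak topology `σ(E, F)` on a subspace `E ⊆ L⁰(μ)` induced by the pairing with `F`. -/
def weakTop (E : Submodule ℝ (Ω →ₘ[μ] ℝ)) (F : Set (Ω →ₘ[μ] ℝ)) : TopologicalSpace E :=
  ⨅ g ∈ F, TopologicalSpace.induced (fun f : E => pair μ (f : Ω →ₘ[μ] ℝ) g) inferInstance

/-- A set `A ⊆ E_K` is `K`-bounded if it is contained in some positive multiple of `K`. -/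
def KBdd (K : Set (Ω →ₘ[μ] ℝ)) (A : Set (EK μ K)) : Prop :=
  ∃ c : ℝ, 0 < c ∧ ∀ f ∈ A, ((f : Ω →ₘ[μ] ℝ)) ∈ c • K

/-- `τ` is an equicontinuous Köthe topology on `E_K` induced by `F`. -/
def IsEquicontKothe (K : Set (Ω →ₘ[μ] ℝ)) (τ : TopologicalSpace (EK μ K))
    (F : Set (Ω →ₘ[μ] ℝ)) : Prop :=
  @IsCompact _ τ {f : EK μ K | (f : Ω →ₘ[μ] ℝ) ∈ K} ∧
  F ⊆ (EK' μ K : Set (Ω →ₘ[μ] ℝ)) ∧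
  IsSubspace μ F ∧
  SolidSet μ F ∧
  (∃ g ∈ F, StrictlyPos μ g) ∧
  Separates μ F (EK μ K) ∧
  ∀ A : Set (EK μ K), KBdd μ K A →
    TopologicalSpace.induced (Subtype.val : A → EK μ K) τ =
      TopologicalSpace.induced (Subtype.val : A → EK μ K) (weakTop μ (EK μ K) F)

/-- `τ` has the Krein-Šmulian property. -/
def KreinSmulian (K : Set (Ω →ₘ[μ] ℝ)) (τ : TopologicalSpace (EK μ K)) : Prop :=
  ∀ C : Set (EK μ K), Convex ℝ C →
    (@IsClosed _ τ C ↔ ∀ c : ℝ, 0 < c → @IsClosed _ τ (C ∩ {f | (f : Ω →ₘ[μ] ℝ) ∈ c • K}))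

/-- Convexity for extended-real-valued functions. -/
def ConvexFn {E : Type*} [AddCommMonoid E] [Module ℝ E] (φ : E → EReal) : Prop :=
  ∀ f g : E, ∀ a b : ℝ, 0 ≤ a → 0 ≤ b → a + b = 1 →
    φ (a • f + b • g) ≤ (a : EReal) * φ f + (b : EReal) * φ g

/-- Properness: `φ` takes values in `(-∞, ∞]` and is not identically `∞`. -/
def ProperFn {E : Type*} (φ : E → EReal) : Prop :=
  (∀ f, φ f ≠ ⊥) ∧ ∃ f, φ f ≠ ⊤

/-- The equicontinuous Fatou property. -/
def EquicontFatou (K : Set (Ω →ₘ[μ] ℝ)) (φ : EK μ K → EReal) : Prop :=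
  ∀ (f : ℕ → EK μ K) (g : EK μ K),
    (∃ c : ℝ, 0 < c ∧ ∀ n, ((f n : Ω →ₘ[μ] ℝ)) ∈ c • K) →
    TendstoInProb μ (fun n => ((f n : Ω →ₘ[μ] ℝ))) (g : Ω →ₘ[μ] ℝ) →
    φ g ≤ liminf (fun n => φ (f n)) atTop

/-- `τ` is `F`-regular: every `τ`-continuous linear functional is represented by some `g ∈ F`. -/
def FRegular (K : Set (Ω →ₘ[μ] ℝ)) (τ : TopologicalSpace (EK μ K))
    (F : Set (Ω →ₘ[μ] ℝ)) : Prop :=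
  ∀ T : EK μ K →ₗ[ℝ] ℝ, @Continuous _ _ τ _ T →
    ∃ g ∈ F, ∀ f : EK μ K, T f = pair μ (f : Ω →ₘ[μ] ℝ) g

/-- The conjugate `φ*` of `φ` at `g`. -/
def phiStar (K : Set (Ω →ₘ[μ] ℝ)) (φ : EK μ K → EReal) (g : Ω →ₘ[μ] ℝ) : EReal :=
  ⨆ h : EK μ K, ((pair μ (h : Ω →ₘ[μ] ℝ) g : ℝ) : EReal) - φ h

/-- The solid hull of `K`. -/
def solidHull (K : Set (Ω →ₘ[μ] ℝ)) : Set (Ω →ₘ[μ] ℝ) :=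
  {f | ∃ g ∈ K, ∀ᵐ ω ∂μ, |f ω| ≤ |g ω|}

/-- `S` is uniformly `ν`-integrable. -/
def UnifInt (ν : Measure Ω) (S : Set (Ω →ₘ[μ] ℝ)) : Prop :=
  (∀ ε : ℝ, 0 < ε → ∃ δ : ℝ, 0 < δ ∧ ∀ A : Set Ω, MeasurableSet A →
      ν A < ENNReal.ofReal δ →
      ∀ f ∈ S, ∫⁻ ω in A, (‖f ω‖₊ : ENNReal) ∂ν < ENNReal.ofReal ε) ∧
  ∃ C : ℝ, ∀ f ∈ S, ∫⁻ ω, (‖f ω‖₊ : ENNReal) ∂ν ≤ ENNReal.ofReal C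

/-- `μ` is non-atomic. -/
def Nonatomic : Prop :=
  ∀ A : Set Ω, MeasurableSet A → 0 < μ A →
    ∃ B : Set Ω, MeasurableSet B ∧ B ⊆ A ∧ 0 < μ B ∧ μ B < μ A

/-- Increasing with respect to the μ-a.e. order. -/
def MonoInc {E : Submodule ℝ (Ω →ₘ[μ] ℝ)} (φ : E → EReal) : Prop :=
  ∀ f h : E, (∀ᵐ ω ∂μ, (f : Ω →ₘ[μ] ℝ) ω ≤ (h : Ω →ₘ[μ] ℝ) ω) → φ f ≤ φ h

/-- Decreasing with respect to the μ-a.e. order. -/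
def MonoDec {E : Submodule ℝ (Ω →ₘ[μ] ℝ)} (φ : E → EReal) : Prop :=
  ∀ f h : E, (∀ᵐ ω ∂μ, (f : Ω →ₘ[μ] ℝ) ω ≤ (h : Ω →ₘ[μ] ℝ) ω) → φ h ≤ φ f

/-- The `F`-positive Hahn-Banach property of `E_K`. -/
def PosHB (K : Set (Ω →ₘ[μ] ℝ)) (F : Set (Ω →ₘ[μ] ℝ)) : Prop :=
  ∀ T : EK μ K →ₗ[ℝ] ℝ,
    @Continuous _ _ (weakTop μ (EK μ K) F) _ T →
    (∀ f : EK μ K, (∀ᵐ ω ∂μ, 0 ≤ (f : Ω →ₘ[μ] ℝ) ω) → 0 ≤ T f) →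
    ∃ S : EK μ (solidHull μ K) →ₗ[ℝ] ℝ,
      @Continuous _ _ (weakTop μ (EK μ (solidHull μ K)) F) _ S ∧
      (∀ f : EK μ (solidHull μ K), (∀ᵐ ω ∂μ, 0 ≤ (f : Ω →ₘ[μ] ℝ) ω) → 0 ≤ S f) ∧
      ∀ (f : Ω →ₘ[μ] ℝ) (hf : f ∈ EK μ K) (hf' : f ∈ EK μ (solidHull μ K)),
        S ⟨f, hf'⟩ = T ⟨f, hf⟩


section Helpers

/-- On a finite measure space, the inclusion of `L²` into `L¹`. -/
def L2toL1 {Ω : Type*} [MeasurableSpace Ω] (μ : Measure Ω) [IsProbabilityMeasure μ] :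
    Lp ℝ 2 μ →L[ℝ] Lp ℝ 1 μ :=
  LinearMap.mkContinuous
    { toFun := fun f => ((Lp.memLp f).mono_exponent one_le_two).toLp f
      map_add' := fun f g => by
        rw [← MemLp.toLp_add]
        exact MemLp.toLp_congr _ _ (Lp.coeFn_add f g)
      map_smul' := fun c f => by
        rw [RingHom.id_apply, ← MemLp.toLp_const_smul]
        exact MemLp.toLp_congr _ _ (Lp.coeFn_smul c f) } 1 fun f => by
    rw [one_mul, LinearMap.coe_mk, AddHom.coe_mk, Lp.norm_toLp, Lp.norm_def]
    exact ENNReal.toReal_mono (Lp.eLpNorm_ne_top f)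
      (eLpNorm_le_eLpNorm_of_exponent_le one_le_two (Lp.aestronglyMeasurable f))

/-- Every continuous linear functional on `L¹` of a probability space is integration against a
bounded function. -/
theorem exists_bounded_density_of_L1_functional {Ω : Type*} [MeasurableSpace Ω] (μ : Measure Ω)
    [IsProbabilityMeasure μ] (T : StrongDual ℝ (Lp ℝ 1 μ)) :
    ∃ v : Ω → ℝ, AEStronglyMeasurable v μ ∧ (∀ᵐ ω ∂μ, |v ω| ≤ ‖T‖) ∧
      ∀ f : Lp ℝ 1 μ, T f = ∫ ω, f ω * v ω ∂μ := by
  set w : Lp ℝ 2 μ := (InnerProductSpace.toDual ℝ (Lp ℝ 2 μ)).symm (T.comp (L2toL1 μ)) with hw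
  have hwint : Integrable w μ :=
    memLp_one_iff_integrable.1 ((Lp.memLp w).mono_exponent one_le_two)
  have hind : ∀ s (hs : MeasurableSet s), ∀ c : ℝ,
      T (indicatorConstLp 1 hs (measure_ne_top μ s) c) = c * ∫ ω in s, w ω ∂μ := by
    intro s hs c
    have h1 : L2toL1 μ (indicatorConstLp 2 hs (measure_ne_top μ s) c)
        = indicatorConstLp 1 hs (measure_ne_top μ s) c :=
      MemLp.toLp_congr ((Lp.memLp _).mono_exponent one_le_two)
        (memLp_indicator_const 1 hs c (Or.inr (measure_ne_top μ s)))
        indicatorConstLp_coeFn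
    rw [← h1, ← ContinuousLinearMap.comp_apply, ← InnerProductSpace.toDual_symm_apply, ← hw,
      real_inner_comm, L2.inner_indicatorConstLp_eq_inner_setIntegral]
    simp [mul_comm]
  have habs : ∀ s, MeasurableSet s → |∫ ω in s, w ω ∂μ| ≤ ‖T‖ * μ.real s := by
    intro s hs
    have h2 := T.le_opNorm (indicatorConstLp 1 hs (measure_ne_top μ s) (1 : ℝ))
    rw [hind s hs 1, one_mul, norm_indicatorConstLp one_ne_zero ENNReal.one_ne_top] at h2
    simpa using h2
  have hle : ∀ᵐ ω ∂μ, w ω ≤ ‖T‖ :=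
    ae_le_of_forall_setIntegral_le hwint (integrable_const _) fun s hs _ => by
      rw [setIntegral_const, smul_eq_mul, mul_comm]
      exact (le_abs_self _).trans (habs s hs)
  have hge : ∀ᵐ ω ∂μ, -‖T‖ ≤ w ω :=
    ae_le_of_forall_setIntegral_le (integrable_const _) hwint fun s hs _ => by
      rw [setIntegral_const, smul_eq_mul, mul_comm, neg_mul]
      exact neg_le_of_abs_le (habs s hs)
  have hbd : ∀ᵐ ω ∂μ, |w ω| ≤ ‖T‖ := by
    filter_upwards [hle, hge] with ω h1 h2 using abs_le.2 ⟨h2, h1⟩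
  have hwm : AEStronglyMeasurable w μ := Lp.aestronglyMeasurable w
  have hmul : ∀ f : Lp ℝ 1 μ, Integrable (fun ω => f ω * w ω) μ := fun f =>
    (L1.integrable_coeFn f).mul_bdd hwm hbd
  refine ⟨w, hwm, hbd, fun f => ?_⟩
  induction f using Lp.induction ENNReal.one_ne_top with
  | @indicatorConst c s hs hμs =>
    rw [Lp.simpleFunc.coe_indicatorConst, hind _ hs c, ← integral_const_mul,
      ← integral_indicator hs]
    refine integral_congr_ae ?_
    filter_upwards [indicatorConstLp_coeFn (p := 1) (hs := hs) (hμs := hμs.ne) (c := c)]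
      with ω hω
    simp only [hω]
    by_cases h : ω ∈ s <;> simp [h]
  | add hf hg _ h1 h2 =>
    rw [map_add, h1, h2, ← integral_add (hmul _) (hmul _)]
    refine integral_congr_ae ?_
    filter_upwards [Lp.coeFn_add (hf.toLp _) (hg.toLp _)] with ω hω
    rw [hω, Pi.add_apply, add_mul]
  | isClosed =>
    refine isClosed_eq T.continuous ?_
    have hL : LipschitzWith ‖T‖₊ (fun f : Lp ℝ 1 μ => ∫ ω, f ω * w ω ∂μ) := by
      refine LipschitzWith.of_dist_le_mul fun f g => ?_
      rw [dist_eq_norm, dist_eq_norm, ← integral_sub (hmul f) (hmul g),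
        L1.norm_eq_integral_norm, coe_nnnorm, ← integral_const_mul]
      refine norm_integral_le_of_norm_le ((L1.integrable_coeFn (f - g)).norm.const_mul _) ?_
      filter_upwards [Lp.coeFn_sub f g, hbd] with ω hω hb
      rw [hω, ← sub_mul, norm_mul, mul_comm, Pi.sub_apply]
      exact mul_le_mul_of_nonneg_right hb (norm_nonneg _)
    exact hL.continuous

variable {μ} {K F : Set (Ω →ₘ[μ] ℝ)}

theorem integrable_mul_of_mem_EK {f g : Ω →ₘ[μ] ℝ} (hf : f ∈ EK μ K) (hg : g ∈ EK' μ K) :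
    Integrable (fun ω => f ω * g ω) μ := by
  induction hf using Submodule.span_induction with
  | mem f hf =>
    induction hg using Submodule.span_induction with
    | mem g hg =>
      refine ⟨f.aestronglyMeasurable.mul g.aestronglyMeasurable, ?_⟩
      exact (hg f hf).trans_lt ENNReal.one_lt_top
    | zero =>
      refine (integrable_zero Ω ℝ μ).congr ?_
      filter_upwards [AEEqFun.coeFn_zero (μ := μ) (β := ℝ)] with ω h
      simp [h]
    | add g₁ g₂ _ _ h₁ h₂ =>
      refine (h₁.add h₂).congr ?_
      filter_upwards [AEEqFun.coeFn_add g₁ g₂] with ω h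
      simp [h, mul_add]
    | smul c g _ h₁ =>
      refine (h₁.const_mul c).congr ?_
      filter_upwards [AEEqFun.coeFn_smul c g] with ω h
      simp [h, mul_left_comm]
  | zero =>
    refine (integrable_zero Ω ℝ μ).congr ?_
    filter_upwards [AEEqFun.coeFn_zero (μ := μ) (β := ℝ)] with ω h
    simp [h]
  | add f₁ f₂ _ _ h₁ h₂ =>
    refine (h₁.add h₂).congr ?_
    filter_upwards [AEEqFun.coeFn_add f₁ f₂] with ω h
    simp [h, add_mul]
  | smul c f _ h₁ =>
    refine (h₁.const_mul c).congr ?_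
    filter_upwards [AEEqFun.coeFn_smul c f] with ω h
    simp [h, mul_assoc]

/-- Every element of `E_K` lies in a positive multiple of `K`, unless `K` is empty. -/
theorem exists_mem_smul_of_mem_EK (hconv : Convex ℝ K) (hbal : Balanced ℝ K) (hne : K.Nonempty)
    {f : Ω →ₘ[μ] ℝ} (hf : f ∈ EK μ K) : ∃ c : ℝ, 0 < c ∧ f ∈ c • K := by
  induction hf using Submodule.span_induction with
  | mem f hf => exact ⟨1, one_pos, by simpa using hf⟩
  | zero => exact ⟨1, one_pos, by simpa using hbal.zero_mem hne⟩
  | add f g _ _ h₁ h₂ =>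
    obtain ⟨a, ha, hfa⟩ := h₁
    obtain ⟨b, hb, hgb⟩ := h₂
    refine ⟨a + b, add_pos ha hb, ?_⟩
    rw [hconv.add_smul ha.le hb.le]
    exact Set.add_mem_add hfa hgb
  | smul r f _ h₁ =>
    obtain ⟨a, ha, hfa⟩ := h₁
    refine ⟨|r * a| + 1, by positivity, ?_⟩
    refine hbal.smul_mono (a := r * a) ?_ ?_
    · rw [Real.norm_eq_abs, Real.norm_eq_abs]
      exact (le_add_of_nonneg_right zero_le_one).trans (le_abs_self _)
    · rw [mul_smul]
      exact Set.smul_mem_smul_set hfa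

theorem continuous_pair_weakTop (E : Submodule ℝ (Ω →ₘ[μ] ℝ)) {g : Ω →ₘ[μ] ℝ} (hg : g ∈ F) :
    Continuous[weakTop μ E F, inferInstance] fun f : E => pair μ (f : Ω →ₘ[μ] ℝ) g :=
  continuous_iInf_dom (i := g) (continuous_iInf_dom (i := hg) continuous_induced_dom)

/-- Closure is determined by the topologies induced on a set containing all points involved. -/
theorem mem_closure_of_induced_eq {X : Type*} {t₁ t₂ : TopologicalSpace X} {A B : Set X} {x : X}
    (h : TopologicalSpace.induced (Subtype.val : A → X) t₁ =
      TopologicalSpace.induced (Subtype.val : A → X) t₂)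
    (hB : B ⊆ A) (hx : x ∈ A) (hxB : x ∈ @closure X t₁ B) : x ∈ @closure X t₂ B := by
  have hB' : (Subtype.val : A → X) '' (Subtype.val ⁻¹' B) = B := by
    rw [Subtype.image_preimage_coe, Set.inter_eq_right.2 hB]
  have h₁ := @closure_induced A X t₁ Subtype.val ⟨x, hx⟩ (Subtype.val ⁻¹' B)
  have h₂ := @closure_induced A X t₂ Subtype.val ⟨x, hx⟩ (Subtype.val ⁻¹' B)
  rw [hB'] at h₁ h₂
  exact h₂.1 (h ▸ h₁.2 hxB)

theorem isCompact_of_induced_eq {X : Type*} {t₁ t₂ : TopologicalSpace X} {A : Set X}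
    (h : TopologicalSpace.induced (Subtype.val : A → X) t₁ =
      TopologicalSpace.induced (Subtype.val : A → X) t₂)
    (hA : @IsCompact X t₁ A) : @IsCompact X t₂ A := by
  rw [@isCompact_iff_isCompact_univ X t₁] at hA
  rw [@isCompact_iff_isCompact_univ X t₂]
  have h' : @instTopologicalSpaceSubtype X (· ∈ A) t₁ = @instTopologicalSpaceSubtype X (· ∈ A) t₂ := h
  rwa [h'] at hA

/-- If `f n → g` a.e. and every pairing of `f n` with elements of `F` clusters at the pairing with
`h`, then `g = h`. -/
theorem ae_eq_of_mapClusterPt_pair (hF : F ⊆ (EK' μ K : Set (Ω →ₘ[μ] ℝ)))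
    (hsol : SolidSet μ F) {g₀ : Ω →ₘ[μ] ℝ} (hg₀ : g₀ ∈ F) (hpos : StrictlyPos μ g₀)
    {f : ℕ → Ω →ₘ[μ] ℝ} {g h : Ω →ₘ[μ] ℝ} (hg : g ∈ EK μ K) (hh : h ∈ EK μ K)
    (hlim : ∀ᵐ ω ∂μ, Tendsto (fun n => f n ω) atTop (𝓝 (g ω)))
    (hcl : ∀ u ∈ F, MapClusterPt (pair μ h u) atTop fun n => pair μ (f n) u) : g = h := by
  have key : ∀ m : ℕ, ∀ᵐ ω ∂μ, (∀ n, |f n ω| * g₀ ω ≤ m) → g ω = h ω := by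
    intro m
    have hfm : ∀ k : Ω →ₘ[μ] ℝ, Measurable k := fun k => k.measurable
    set A : Set Ω := {ω | ∀ n, |f n ω| * g₀ ω ≤ m} with hA
    have hAm : MeasurableSet A := by
      rw [hA, Set.ofPred_forall]
      exact MeasurableSet.iInter fun n =>
        measurableSet_le ((hfm (f n)).abs.mul (hfm g₀)) measurable_const
    set s : Ω → ℝ := fun ω => A.indicator (fun ω => (if 0 ≤ g ω - h ω then 1 else -1) * g₀ ω) ω with hs
    have hsm : Measurable s := by
      refine Measurable.indicator (Measurable.mul ?_ (hfm g₀)) hAm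
      exact Measurable.ite (measurableSet_le measurable_const ((hfm g).sub (hfm h)))
        measurable_const measurable_const
    set u : Ω →ₘ[μ] ℝ := AEEqFun.mk s hsm.aestronglyMeasurable with hu
    have hus : u =ᵐ[μ] s := AEEqFun.coeFn_mk _ _
    have hsle : ∀ ω, |s ω| ≤ |g₀ ω| := by
      intro ω
      by_cases hω : ω ∈ A
      · simp only [hs, Set.indicator_of_mem hω, abs_mul]
        refine mul_le_of_le_one_left (abs_nonneg _) ?_
        split_ifs <;> simp
      · simp [hs, Set.indicator_of_notMem hω]
    have huF : u ∈ F := hsol g₀ hg₀ u (by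
      filter_upwards [hus] with ω hω
      rw [hω]; exact hsle ω)
    have htend : Tendsto (fun n => pair μ (f n) u) atTop (𝓝 (pair μ g u)) := by
      refine tendsto_integral_of_dominated_convergence (fun _ => (m : ℝ))
        (fun n => (f n).aestronglyMeasurable.mul u.aestronglyMeasurable) (integrable_const _)
        (fun n => ?_) ?_
      · filter_upwards [hus, hpos] with ω hω hp
        rw [hω, Real.norm_eq_abs, abs_mul]
        by_cases hωA : ω ∈ A
        · refine (mul_le_mul_of_nonneg_left (hsle ω) (abs_nonneg _)).trans ?_
          rw [abs_of_pos hp]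
          exact hωA n
        · simp [hs, Set.indicator_of_notMem hωA]
      · filter_upwards [hlim] with ω hω using hω.mul_const _
    have heq : pair μ h u = pair μ g u :=
      eq_of_nhds_neBot ((hcl u huF).clusterPt.neBot.mono (inf_le_inf_left _ htend))
    have hi1 := integrable_mul_of_mem_EK hg (hF huF)
    have hi2 := integrable_mul_of_mem_EK hh (hF huF)
    have hzero : ∫ ω, (g ω * u ω - h ω * u ω) ∂μ = 0 := by
      rw [integral_sub hi1 hi2]
      exact sub_eq_zero.2 heq.symm
    have hval : ∀ᵐ ω ∂μ, ω ∈ A → g ω * u ω - h ω * u ω = |g ω - h ω| * g₀ ω := by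
      filter_upwards [hus] with ω hω hωA
      rw [hω, ← sub_mul]
      simp only [hs, Set.indicator_of_mem hωA]
      split_ifs with h'
      · rw [abs_of_nonneg h', one_mul]
      · rw [abs_of_neg (not_le.1 h')]
        ring
    have hnn : 0 ≤ᵐ[μ] fun ω => g ω * u ω - h ω * u ω := by
      filter_upwards [hus, hval, hpos] with ω hω hv hp
      by_cases hωA : ω ∈ A
      · rw [hv hωA]; exact mul_nonneg (abs_nonneg _) hp.le
      · simp [hω, hs, Set.indicator_of_notMem hωA]
    have hz := (integral_eq_zero_iff_of_nonneg_ae hnn (hi1.sub hi2)).1 hzero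
    filter_upwards [hz, hval, hpos] with ω h0 hv hp hωA
    have h1 := (hv hωA).symm.trans h0
    have h2 : |g ω - h ω| = 0 := by
      rcases mul_eq_zero.1 h1 with h' | h'
      · exact h'
      · exact absurd h' hp.ne'
    exact sub_eq_zero.1 (abs_eq_zero.1 h2)
  refine AEEqFun.ext ?_
  filter_upwards [ae_all_iff.2 key, hlim, hpos] with ω hk hl hp
  obtain ⟨C, hC⟩ := (hl.abs.mul_const (g₀ ω)).bddAbove_range
  obtain ⟨m, hm⟩ := exists_nat_ge C
  exact hk m fun n => (hC ⟨n, rfl⟩).trans hm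

/-- If a sequence in `c • K` converges a.e., its limit lies in the weak closure of its range. -/
theorem mem_closure_weakTop_of_tendsto_ae (hF : F ⊆ (EK' μ K : Set (Ω →ₘ[μ] ℝ)))
    (hsol : SolidSet μ F) {g₀ : Ω →ₘ[μ] ℝ} (hg₀ : g₀ ∈ F) (hpos : StrictlyPos μ g₀)
    (hcomp : @IsCompact _ (weakTop μ (EK μ K) F) {f : EK μ K | (f : Ω →ₘ[μ] ℝ) ∈ K})
    {f : ℕ → EK μ K} {g : EK μ K} {c : ℝ} (hc : 0 < c)
    (hf : ∀ n, (f n : Ω →ₘ[μ] ℝ) ∈ c • K)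
    (hlim : ∀ᵐ ω ∂μ, Tendsto (fun n => (f n : Ω →ₘ[μ] ℝ) ω) atTop
      (𝓝 ((g : Ω →ₘ[μ] ℝ) ω))) :
    g ∈ @closure _ (weakTop μ (EK μ K) F) (Set.range f) := by
  let _ := weakTop μ (EK μ K) F
  have hsc : Continuous fun x : EK μ K => c • x := by
    refine continuous_iInf_rng.2 fun u => continuous_iInf_rng.2 fun hu =>
      continuous_induced_rng.2 ?_
    refine ((continuous_pair_weakTop (EK μ K) hu).const_mul c).congr fun x => ?_
    rw [pair, ← integral_const_mul]
    refine integral_congr_ae ?_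
    filter_upwards [AEEqFun.coeFn_smul c (x : Ω →ₘ[μ] ℝ)] with ω hω
    simp [hω, mul_assoc]
  have hmem : ∀ n, c⁻¹ • f n ∈ {f : EK μ K | (f : Ω →ₘ[μ] ℝ) ∈ K} := fun n =>
    (Set.mem_smul_set_iff_inv_smul_mem₀ hc.ne' K (f n : Ω →ₘ[μ] ℝ)).1 (hf n)
  obtain ⟨h, -, hh⟩ := hcomp.exists_mapClusterPt (f := atTop) (u := fun n => c⁻¹ • f n)
    (tendsto_principal.2 (Eventually.of_forall hmem))
  have hclus : MapClusterPt (c • h) atTop f := by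
    have := hh.continuousAt_comp (hsc.continuousAt (x := h))
    simpa [Function.comp_def, smul_smul, hc.ne'] using this
  have hgh : g = c • h := Subtype.ext <|
    ae_eq_of_mapClusterPt_pair hF hsol hg₀ hpos g.2 (c • h).2 hlim fun u hu =>
      hclus.continuousAt_comp ((continuous_pair_weakTop (EK μ K) hu).continuousAt)
  rw [hgh]
  exact mem_closure_iff_clusterPt.2 (hclus.clusterPt.mono (by
    simp [Filter.le_principal_iff]))

/-- Points in the weak closure of a convex set are limits in probability of sequences from it. -/
theorem exists_seq_tendstoInProb_of_mem_closure_weakTop (hF : F ⊆ (EK' μ K : Set (Ω →ₘ[μ] ℝ)))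
    (hsub : IsSubspace μ F)
    (hsol : SolidSet μ F) {g₀ : Ω →ₘ[μ] ℝ} (hg₀ : g₀ ∈ F) (hpos : StrictlyPos μ g₀)
    {C : Set (EK μ K)} (hC : Convex ℝ C) {x : EK μ K}
    (hx : x ∈ @closure _ (weakTop μ (EK μ K) F) C) :
    ∃ y : ℕ → EK μ K, (∀ n, y n ∈ C) ∧
      TendstoInProb μ (fun n => (y n : Ω →ₘ[μ] ℝ)) (x : Ω →ₘ[μ] ℝ) := by
  have hint : ∀ f : EK μ K, Integrable (fun ω => (f : Ω →ₘ[μ] ℝ) ω * g₀ ω) μ := fun f =>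
    integrable_mul_of_mem_EK f.2 (hF hg₀)
  let L : EK μ K →ₗ[ℝ] Lp ℝ 1 μ :=
    { toFun := fun f => (hint f).toL1
      map_add' := fun f g => by
        rw [← Integrable.toL1_add, Integrable.toL1_eq_toL1_iff]
        filter_upwards [AEEqFun.coeFn_add (f : Ω →ₘ[μ] ℝ) g] with ω h
        simp [h, add_mul]
      map_smul' := fun c f => by
        rw [RingHom.id_apply, ← Integrable.toL1_smul', Integrable.toL1_eq_toL1_iff]
        filter_upwards [AEEqFun.coeFn_smul c (f : Ω →ₘ[μ] ℝ)] with ω h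
        simp [h, mul_assoc] }
  have hL : ∀ f : EK μ K, L f =ᵐ[μ] fun ω => (f : Ω →ₘ[μ] ℝ) ω * g₀ ω := fun f =>
    Integrable.coeFn_toL1 (hint f)
  have hmem : L x ∈ closure (L '' C) := by
    by_contra hnot
    obtain ⟨T, r, hT, hr⟩ :=
      geometric_hahn_banach_closed_point (hC.linear_image L).closure isClosed_closure hnot
    obtain ⟨v, hvm, hvb, hv⟩ := exists_bounded_density_of_L1_functional μ T
    set u : Ω →ₘ[μ] ℝ := AEEqFun.mk (fun ω => g₀ ω * v ω) (g₀.aestronglyMeasurable.mul hvm)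
    have hu : u =ᵐ[μ] fun ω => g₀ ω * v ω := AEEqFun.coeFn_mk _ _
    have huF : u ∈ F := by
      refine hsol (‖T‖ • g₀) (hsub.2.2 _ _ hg₀) u ?_
      filter_upwards [hu, hvb, AEEqFun.coeFn_smul ‖T‖ g₀] with ω h1 h2 h3
      rw [h1, h3, Pi.smul_apply, smul_eq_mul, abs_mul, abs_mul, mul_comm, abs_norm]
      exact mul_le_mul_of_nonneg_right h2 (abs_nonneg _)
    have hTL : ∀ f : EK μ K, T (L f) = pair μ (f : Ω →ₘ[μ] ℝ) u := by
      intro f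
      rw [hv, pair]
      refine integral_congr_ae ?_
      filter_upwards [hL f, hu] with ω h1 h2
      rw [h1, h2, mul_assoc]
    let _ := weakTop μ (EK μ K) F
    have hclosed : IsClosed {f : EK μ K | pair μ (f : Ω →ₘ[μ] ℝ) u ≤ r} :=
      isClosed_le (continuous_pair_weakTop (EK μ K) huF) continuous_const
    have hle : pair μ (x : Ω →ₘ[μ] ℝ) u ≤ r :=
      closure_minimal (fun f hf => by
        rw [Set.mem_ofPred_eq, ← hTL]
        exact (hT _ (subset_closure (Set.mem_image_of_mem L hf))).le) hclosed hx
    exact absurd hr (not_lt.2 (hTL x ▸ hle))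
  obtain ⟨z, hz, hzlim⟩ := mem_closure_iff_seq_limit.1 hmem
  choose y hyC hyz using hz
  obtain ⟨ns, -, hns⟩ := (tendstoInMeasure_of_tendsto_Lp hzlim).exists_seq_tendsto_ae
  refine ⟨fun n => y (ns n), fun n => hyC _, ?_⟩
  refine tendstoInMeasure_of_tendsto_ae (fun n => AEEqFun.aestronglyMeasurable _) ?_
  filter_upwards [hns, hL x, ae_all_iff.2 fun n => hL (y n), hpos] with ω h1 h2 h3 hp
  have h4 := h1.div_const (g₀ ω)
  simpa [← hyz, h2, h3, hp.ne'] using h4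

end Helpers

section Theorems

variable (K : Set (Ω →ₘ[μ] ℝ))

theorem stmt0
    (hconv : Convex ℝ K) (hbal : Balanced ℝ K)
    (hcl : ClosedInProb μ K) (hbdd : BoundedInProb μ K)
    (τ : TopologicalSpace (EK μ K)) (F : Set (Ω →ₘ[μ] ℝ))
    (hτ : IsEquicontKothe μ K τ F)
    (φ : EK μ K → EReal) (hφc : ConvexFn φ) (hφp : ProperFn φ) :
    (∀ lam ε : ℝ, 0 < ε →
        @IsClosed _ τ {f : EK μ K | φ f ≤ (lam : EReal) ∧ (f : Ω →ₘ[μ] ℝ) ∈ ε • K}) ↔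
      EquicontFatou μ K φ := by
  obtain ⟨hcomp, hF, hsub, hsol, ⟨g₀, hg₀, hpos⟩, -, hind⟩ := hτ
  have hmono : ∀ {a b : ℝ}, 0 < a → a ≤ b → a • K ⊆ b • K := fun ha hab =>
    hbal.smul_mono (by rwa [Real.norm_of_nonneg ha.le, Real.norm_of_nonneg (ha.le.trans hab)])
  have hbd : ∀ {B : Set (EK μ K)} {c : ℝ} {x : EK μ K}, 0 < c → B.Nonempty →
      (∀ f ∈ B, (f : Ω →ₘ[μ] ℝ) ∈ c • K) → KBdd μ K (insert x B) := by
    rintro B c x hc ⟨b, hb⟩ hB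
    have hne : K.Nonempty := Set.smul_set_nonempty.1 ⟨_, hB b hb⟩
    obtain ⟨d, hd, hxd⟩ := exists_mem_smul_of_mem_EK hconv hbal hne x.2
    refine ⟨max c d, lt_max_of_lt_left hc, ?_⟩
    rintro f (rfl | hf)
    · exact hmono hd (le_max_right _ _) hxd
    · exact hmono hc (le_max_left _ _) (hB f hf)
  constructor
  · rintro hclosed f g ⟨c, hc, hf⟩ hfg
    by_contra hlt
    obtain ⟨lam, h1, h2⟩ := EReal.lt_iff_exists_real_btwn.1 (not_le.1 hlt)
    obtain ⟨ns, hns, hlam⟩ := extraction_of_frequently_atTop (frequently_lt_of_liminf_lt (h := h1))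
    obtain ⟨ms, -, hae⟩ := (hfg.comp hns.tendsto_atTop).exists_seq_tendsto_ae
    have hwcomp := isCompact_of_induced_eq
      (hind {f : EK μ K | (f : Ω →ₘ[μ] ℝ) ∈ K} ⟨1, one_pos, fun f hf => by simpa using hf⟩) hcomp
    have hweak : g ∈ @closure _ (weakTop μ (EK μ K) F) (Set.range fun n => f (ns (ms n))) :=
      mem_closure_weakTop_of_tendsto_ae hF hsol hg₀ hpos hwcomp hc (fun n => hf _) hae
    have hτcl := mem_closure_of_induced_eq
      (hind _ (hbd (x := g) hc (Set.range_nonempty _) (by rintro _ ⟨n, rfl⟩; exact hf _))).symm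
      (Set.subset_insert _ _) (Set.mem_insert _ _) hweak
    have hsubset : (Set.range fun n => f (ns (ms n))) ⊆
        {f : EK μ K | φ f ≤ (lam : EReal) ∧ (f : Ω →ₘ[μ] ℝ) ∈ c • K} := by
      rintro _ ⟨n, rfl⟩
      exact ⟨(hlam _).le, hf _⟩
    have hmem := (@IsClosed.closure_eq _ τ _ (hclosed lam c hc)).subset
      (@closure_mono _ τ _ _ hsubset g hτcl)
    exact absurd h2 (not_lt.2 hmem.1)
  · intro hfat lam ε hε
    refine @isClosed_of_closure_subset _ τ _ fun x hx => ?_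
    have hne := (@closure_nonempty_iff _ τ _).1 ⟨x, hx⟩
    have hweak := mem_closure_of_induced_eq
      (hind _ (hbd (x := x) hε hne fun f hf => hf.2))
      (Set.subset_insert _ _) (Set.mem_insert _ _) hx
    have hC : Convex ℝ {f : EK μ K | φ f ≤ (lam : EReal) ∧ (f : Ω →ₘ[μ] ℝ) ∈ ε • K} := by
      intro f hf g hg a b ha hb hab
      refine ⟨(hφc f g a b ha hb hab).trans ?_, hconv.smul ε hf.2 hg.2 ha hb hab⟩
      refine (add_le_add (mul_le_mul_of_nonneg_left hf.1 (EReal.coe_nonneg.2 ha))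
        (mul_le_mul_of_nonneg_left hg.1 (EReal.coe_nonneg.2 hb))).trans ?_
      rw [← EReal.coe_mul, ← EReal.coe_mul, ← EReal.coe_add, ← add_mul, hab, one_mul]
    obtain ⟨y, hyC, hy⟩ :=
      exists_seq_tendstoInProb_of_mem_closure_weakTop hF hsub hsol hg₀ hpos hC hweak
    refine ⟨?_, ?_⟩
    · refine (hfat y x ⟨ε, hε, fun n => (hyC n).2⟩ hy).trans ?_
      refine (liminf_le_liminf (v := fun _ => (lam : EReal))
        (Eventually.of_forall fun n => (hyC n).1)).trans ?_
      simp
    · rw [Set.mem_smul_set_iff_inv_smul_mem₀ hε.ne']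
      obtain ⟨ns, -, hae⟩ := hy.exists_seq_tendsto_ae
      refine hcl (fun n => ε⁻¹ • (y (ns n) : Ω →ₘ[μ] ℝ))
        (fun n => (Set.mem_smul_set_iff_inv_smul_mem₀ hε.ne' _ _).1 (hyC _).2) _ ?_
      refine tendstoInMeasure_of_tendsto_ae (fun n => AEEqFun.aestronglyMeasurable _) ?_
      filter_upwards [hae, AEEqFun.coeFn_smul ε⁻¹ (x : Ω →ₘ[μ] ℝ),
        ae_all_iff.2 fun n => AEEqFun.coeFn_smul ε⁻¹ (y (ns n) : Ω →ₘ[μ] ℝ)] with ω h1 h2 h3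
      simp only [h2, h3, Pi.smul_apply]
      exact h1.const_smul _

end Theorems

end EquicontKothe
end
end

section
/- If E_K admits an equicontinuous Köthe topology τ induced by F, then there exists a probability measure ν on (Ω, 𝓕) equivalent to μ such that dν/dμ ∈ F and K is uniformly ν-integrable. -/
open MeasureTheory Filter Topology Pointwise

noncomputable section

namespace EquicontKothe

variable {Ω : Type*} [MeasurableSpace Ω] (μ : Measure Ω) [IsProbabilityMeasure μ]

theorem tendsto_update_self_atTop {β : Type*} [TopologicalSpace β] (s : ℕ → β) (b : β) :
    Tendsto (fun n => Function.update s n b) atTop (𝓝 s) := by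
  rw [tendsto_pi_nhds]
  intro m
  refine tendsto_const_nhds.congr' ?_
  filter_upwards [eventually_gt_atTop m] with n hn
  rw [Function.update_of_ne hn.ne]

theorem exists_abs_diagonal_lt {X : Type*} [TopologicalSpace X] [CompactSpace X]
    (a : X → ℕ → ℝ) (hs : ∀ x, Summable (a x))
    (hc : ∀ s : ℕ → Bool, Continuous fun x => ∑' n, if s n then a x n else 0)
    (x : ℕ → X) {ε : ℝ} (hε : 0 < ε) : ∃ k, |a (x k) k| < ε := by
  set S : X → (ℕ → Bool) → ℝ := fun x s => ∑' n, if s n then a x n else 0 with hS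
  have hsum : ∀ x (s : ℕ → Bool), Summable fun n => if s n then a x n else 0 := by
    intro x s
    refine Summable.of_norm_bounded (hs x).abs fun n => ?_
    split_ifs <;> simp
  have hScont : ∀ x, Continuous (S x) := by
    intro x
    refine continuous_tsum (u := fun n => |a x n|) (fun n => ?_) (hs x).abs fun n s => ?_
    · exact (continuous_of_discreteTopology (f := fun b : Bool => if b then a x n else 0)).comp
        (continuous_apply n)
    · split_ifs <;> simp
  have hdiff : ∀ x (s : ℕ → Bool) n,
      S x (Function.update s n true) - S x (Function.update s n false) = a x n := by
    intro x s n
    rw [hS, ← (hsum x _).tsum_sub (hsum x _), tsum_eq_single n]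
    · simp
    · intro m hm
      simp [Function.update_of_ne hm]
  have hacont : Continuous a := by
    refine continuous_pi fun n => ?_
    have := (hc (Function.update (fun _ => false) n true)).sub
      (hc (Function.update (fun _ => false) n false))
    exact this.congr fun x => hdiff x _ n
  obtain ⟨-, ⟨y, rfl⟩, φ, hφ, hlim⟩ :=
    (isCompact_range hacont).tendsto_subseq (x := fun k => a (x k)) fun k => ⟨x k, rfl⟩
  have hSlim : ∀ s, Tendsto (fun k => S (x (φ k)) s) atTop (𝓝 (S y s)) := by
    intro s
    rw [tendsto_iff_ultrafilter]
    intro U hU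
    obtain ⟨z, -, hz⟩ := isCompact_univ.ultrafilter_le_nhds (U.map fun k => x (φ k)) (by simp)
    have hz' : Tendsto (fun k => x (φ k)) U (𝓝 z) := hz
    have haz : a z = a y :=
      tendsto_nhds_unique ((hacont.tendsto z).comp hz') (hlim.mono_left hU)
    have := ((hc s).tendsto z).comp hz'
    simp only [haz, Function.comp_def] at this
    exact this
  set E : ℕ → Set (ℕ → Bool) := fun N => {s | ∀ k ≥ N, |S (x (φ k)) s - S y s| ≤ ε / 4} with hE
  have hEclosed : ∀ N, IsClosed (E N) := by
    intro N
    simp only [hE, Set.ofPred_forall]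
    exact isClosed_iInter fun k => isClosed_iInter fun _ =>
      isClosed_le ((hScont _).sub (hScont _)).abs continuous_const
  have hEunion : ⋃ N, E N = Set.univ := by
    refine Set.eq_univ_of_forall fun s => Set.mem_iUnion.2 ?_
    obtain ⟨N, hN⟩ := Metric.tendsto_atTop.1 (hSlim s) (ε / 4) (by positivity)
    exact ⟨N, fun k hk => (hN k hk).le⟩
  obtain ⟨N, s, hsN⟩ := nonempty_interior_of_iUnion_of_closed hEclosed hEunion
  have hnhds : E N ∈ 𝓝 s := mem_interior_iff_mem_nhds.1 hsN
  have hev : ∀ᶠ n in atTop, |a y n| < ε / 2 := by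
    have := (hs y).tendsto_atTop_zero.abs
    rw [abs_zero] at this
    exact this.eventually (gt_mem_nhds (by positivity))
  have hall := ((tendsto_update_self_atTop s true).eventually hnhds).and
    (((tendsto_update_self_atTop s false).eventually hnhds).and hev)
  obtain ⟨k, ⟨h1, h2, h3⟩, hk⟩ :=
    ((hφ.tendsto_atTop.eventually hall).and (eventually_ge_atTop N)).exists
  refine ⟨φ k, ?_⟩
  have h1 := abs_le.1 (h1 k hk)
  have h2 := abs_le.1 (h2 k hk)
  have h3 := abs_lt.1 h3
  have e1 := hdiff (x (φ k)) s (φ k)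
  have e2 := hdiff y s (φ k)
  rw [abs_lt]
  constructor <;> linarith

theorem exists_abs_setIntegral_lt {X : Type*} [TopologicalSpace X] [CompactSpace X]
    {Ω : Type*} [MeasurableSpace Ω] (ν : Measure Ω) (f : X → Ω → ℝ) (hf : ∀ x, Integrable (f x) ν)
    (hc : ∀ A, MeasurableSet A → Continuous fun x => ∫ ω in A, f x ω ∂ν)
    (A : ℕ → Set Ω) (hA : ∀ n, MeasurableSet (A n)) (hd : Pairwise (Function.onFun Disjoint A))
    (x : ℕ → X) {ε : ℝ} (hε : 0 < ε) : ∃ k, |∫ ω in A k, f (x k) ω ∂ν| < ε := by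
  refine exists_abs_diagonal_lt (fun x n => ∫ ω in A n, f x ω ∂ν)
    (fun x => (hasSum_integral_iUnion hA hd (hf x).integrableOn).summable) (fun s => ?_) x hε
  have hB : ∀ n, MeasurableSet (if s n then A n else ∅) := by
    intro n
    split_ifs <;> simp [hA]
  refine (hc _ (MeasurableSet.iUnion hB)).congr fun x => ?_
  rw [integral_iUnion hB (fun i j hij => ?_) (hf x).integrableOn]
  · refine tsum_congr fun n => ?_
    split_ifs <;> simp
  · have := hd hij
    simp only [Function.onFun] at this ⊢
    split_ifs <;> simp [this]

theorem exists_subset_abs_setIntegral_ge {Ω : Type*} [MeasurableSpace Ω] {ν : Measure Ω}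
    {f : Ω → ℝ} (hf : Integrable f ν)
    {A : Set Ω} (hA : MeasurableSet A) {ε : ℝ}
    (h : ENNReal.ofReal (2 * ε) ≤ ∫⁻ ω in A, ‖f ω‖ₑ ∂ν) :
    ∃ B ⊆ A, MeasurableSet B ∧ ε ≤ |∫ ω in B, f ω ∂ν| := by
  obtain ⟨g, hg, hfg⟩ := hf.1
  have hgi : Integrable g ν := hf.congr hfg
  have hP : MeasurableSet {ω | 0 ≤ g ω} := measurableSet_le measurable_const hg.measurable
  have hN : {ω | 0 ≤ g ω}ᶜ = {ω | g ω < 0} := by ext; simp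
  have hnorm : 2 * ε ≤ ∫ ω in A, |g ω| ∂ν := by
    have h' : ENNReal.ofReal (2 * ε) ≤ ∫⁻ ω in A, ‖g ω‖ₑ ∂ν := by
      refine h.trans_eq (lintegral_congr_ae (ae_restrict_of_ae ?_))
      filter_upwards [hfg] with ω hω using by rw [hω]
    rw [← ofReal_integral_norm_eq_lintegral_enorm hgi.integrableOn] at h'
    exact (ENNReal.ofReal_le_ofReal_iff (integral_nonneg fun _ => norm_nonneg _)).1 h'
  have hsplit : ∫ ω in A, |g ω| ∂ν =
      ∫ ω in A ∩ {ω | 0 ≤ g ω}, g ω ∂ν - ∫ ω in A ∩ {ω | g ω < 0}, g ω ∂ν := by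
    rw [← integral_inter_add_sdiff hP hgi.abs.integrableOn, Set.sdiff_eq, hN, sub_eq_add_neg,
      ← integral_neg]
    congr 1
    · exact setIntegral_congr_fun (hA.inter hP) fun ω hω => abs_of_nonneg hω.2
    · exact setIntegral_congr_fun (hA.inter (hN ▸ hP.compl)) fun ω hω => abs_of_neg hω.2
  have hcongr : ∀ B, ∫ ω in B, f ω ∂ν = ∫ ω in B, g ω ∂ν := fun B =>
    integral_congr_ae (ae_restrict_of_ae hfg)
  by_cases h1 : ε ≤ ∫ ω in A ∩ {ω | 0 ≤ g ω}, g ω ∂ν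
  · exact ⟨_, Set.inter_subset_left, hA.inter hP, (hcongr _).symm ▸ h1.trans (le_abs_self _)⟩
  · refine ⟨A ∩ {ω | g ω < 0}, Set.inter_subset_left, hA.inter (hN ▸ hP.compl), ?_⟩
    rw [hcongr]
    exact le_trans (by linarith) (neg_le_abs _)

theorem exists_seq_tsum_tail_lt {α : Type*} (P : ENNReal → α → Prop)
    (hP : ∀ δ, 0 < δ → ∃ a, P δ a) (D : α → ENNReal) (hD : ∀ a, 0 < D a) :
    ∃ (δ : ℕ → ENNReal) (a : ℕ → α), (∀ k, P (δ k) (a k)) ∧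
      ∀ k, ∑' j, δ (k + 1 + j) < D (a k) := by
  classical
  have : Nonempty α := ⟨(hP 1 one_pos).choose⟩
  choose! b hb using hP
  let δ : ℕ → ENNReal := fun n => Nat.rec 1 (fun _ d => min d (min 1 (D (b d))) / 4) n
  have hδ : ∀ n, δ (n + 1) = min (δ n) (min 1 (D (b (δ n)))) / 4 := fun n => rfl
  have hpos : ∀ n, 0 < δ n := by
    intro n
    induction n with
    | zero => exact one_pos
    | succ n ih =>
      rw [hδ]
      exact ENNReal.div_pos (lt_min ih (lt_min one_pos (hD _))).ne' (by simp)
  refine ⟨δ, fun n => b (δ n), fun k => hb _ (hpos k), fun k => ?_⟩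
  have hstep : ∀ n, δ (n + 1) ≤ 2⁻¹ * δ n := by
    intro n
    rw [hδ, ENNReal.div_eq_inv_mul]
    gcongr
    · norm_num
    · exact min_le_left _ _
  have hgeom : ∀ j, δ (k + 1 + j) ≤ 2⁻¹ ^ j * δ (k + 1) := by
    intro j
    induction j with
    | zero => simp
    | succ j ih =>
      refine (hstep (k + 1 + j)).trans ?_
      rw [pow_succ', mul_assoc]
      exact mul_le_mul_right ih _
  set m := min 1 (D (b (δ k))) with hm
  have hm0 : m ≠ 0 := (lt_min one_pos (hD _)).ne'
  have hmt : m ≠ ⊤ := ((min_le_left _ _).trans_lt ENNReal.one_lt_top).ne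
  calc ∑' j, δ (k + 1 + j) ≤ ∑' j : ℕ, 2⁻¹ ^ j * δ (k + 1) := ENNReal.tsum_le_tsum hgeom
    _ = 2 * δ (k + 1) := by rw [ENNReal.tsum_mul_right, ENNReal.tsum_geometric_two]
    _ ≤ 2 * (m / 4) := by
      rw [hδ]
      gcongr
      exact min_le_right _ _
    _ = m / 2 := by
      rw [ENNReal.div_eq_inv_mul, ENNReal.div_eq_inv_mul, ← mul_assoc]
      congr 1
      rw [show (4 : ENNReal) = 2 * 2 by norm_num, ENNReal.mul_inv (by simp) (by simp), ← mul_assoc,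
        ENNReal.mul_inv_cancel (by simp) (by simp), one_mul]
    _ < m := ENNReal.half_lt_self hm0 hmt
    _ ≤ D (b (δ k)) := min_le_right _ _

theorem uniformly_small_setLIntegral {X : Type*} [TopologicalSpace X] [CompactSpace X]
    {Ω : Type*} [MeasurableSpace Ω] (ν : Measure Ω) (f : X → Ω → ℝ) (hf : ∀ x, Integrable (f x) ν)
    (hc : ∀ A, MeasurableSet A → Continuous fun x => ∫ ω in A, f x ω ∂ν)
    {ε : ENNReal} (hε : 0 < ε) :
    ∃ δ : ENNReal, 0 < δ ∧ ∀ A, MeasurableSet A → ν A < δ →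
      ∀ x, ∫⁻ ω in A, ‖f x ω‖ₑ ∂ν < ε := by
  by_contra! hcon
  obtain ⟨η, hη, hηε⟩ : ∃ η : ℝ, 0 < η ∧ ENNReal.ofReal (4 * η) ≤ ε := by
    obtain ⟨r, hr0, hr⟩ := ENNReal.lt_iff_exists_real_btwn.1 hε
    refine ⟨r / 4, ?_, ?_⟩
    · have := hr.1
      rw [ENNReal.ofReal_pos] at this
      positivity
    · rw [show 4 * (r / 4) = r by ring]
      exact hr.2.le
  have hsmall : ∀ x, ∃ δ : ENNReal, 0 < δ ∧ ∀ s, ν s < δ →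
      ∫⁻ ω in s, ‖f x ω‖ₑ ∂ν < ENNReal.ofReal (2 * η) := fun x =>
    exists_pos_setLIntegral_lt_of_measure_lt (hf x).2.ne (by simpa using hη)
  choose D hD0 hD using hsmall
  obtain ⟨δ, a, hPa, htail⟩ := exists_seq_tsum_tail_lt
    (fun δ (p : Set Ω × X) => MeasurableSet p.1 ∧ ν p.1 < δ ∧ ε ≤ ∫⁻ ω in p.1, ‖f p.2 ω‖ₑ ∂ν)
    (fun δ hδ => by
      obtain ⟨A, hA, hν, x, hx⟩ := hcon δ hδ
      exact ⟨(A, x), hA, hν, hx⟩) (fun p => D p.2) (fun p => hD0 p.2)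
  set C : ℕ → Set Ω := fun k => ⋃ j, (a (k + 1 + j)).1 with hCdef
  have hCmeas : ∀ k, MeasurableSet (C k) := fun k => MeasurableSet.iUnion fun j => (hPa _).1
  have hC : ∀ k, ν (C k) < D (a k).2 := fun k =>
    ((measure_iUnion_le _).trans (ENNReal.tsum_le_tsum fun j => (hPa _).2.1.le)).trans_lt (htail k)
  have hlarge : ∀ k, ENNReal.ofReal (2 * η) ≤ ∫⁻ ω in (a k).1 \ C k, ‖f (a k).2 ω‖ₑ ∂ν := by
    intro k
    by_contra! hlt
    have hle : ∫⁻ ω in (a k).1, ‖f (a k).2 ω‖ₑ ∂ν ≤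
        ∫⁻ ω in (a k).1 \ C k, ‖f (a k).2 ω‖ₑ ∂ν + ∫⁻ ω in C k, ‖f (a k).2 ω‖ₑ ∂ν :=
      (lintegral_mono_set (by simp)).trans (lintegral_union_le _ ((a k).1 \ C k) (C k))
    refine absurd ((hPa k).2.2.trans hle) (not_le.2 ?_)
    refine (ENNReal.add_lt_add hlt (hD _ _ (hC k))).trans_le ?_
    rw [← ENNReal.ofReal_add (by positivity) (by positivity)]
    rwa [show 2 * η + 2 * η = 4 * η by ring]
  choose B hBsub hBmeas hB using fun k =>
    exists_subset_abs_setIntegral_ge (hf (a k).2) ((hPa k).1.diff (hCmeas k)) (hlarge k)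
  have hdisj : Pairwise (Function.onFun Disjoint B) := by
    rw [pairwise_disjoint_on]
    intro m n hmn
    refine Set.disjoint_left.2 fun ω hm hn => (hBsub m hm).2 (Set.mem_iUnion.2 ⟨n - (m + 1), ?_⟩)
    rw [Nat.add_sub_cancel' hmn]
    exact (hBsub n hn).1
  obtain ⟨k, hk⟩ := exists_abs_setIntegral_lt ν f hf hc B hBmeas hdisj (fun k => (a k).2) hη
  exact absurd (hB k) (not_le.2 hk)

theorem exists_lintegral_mul_le_of_mem_EK' {K : Set (Ω →ₘ[μ] ℝ)} {g : Ω →ₘ[μ] ℝ}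
    (hg : g ∈ EK' μ K) :
    ∃ C : NNReal, ∀ f ∈ K, ∫⁻ ω, ‖f ω * g ω‖ₑ ∂μ ≤ C := by
  induction hg using Submodule.span_induction with
  | mem g hg => exact ⟨1, fun f hf => hg f hf⟩
  | zero =>
    refine ⟨0, fun f _ => ?_⟩
    rw [lintegral_congr_ae (g := fun _ => 0)]
    · simp
    · filter_upwards [AEEqFun.coeFn_zero (μ := μ) (β := ℝ)] with ω hω
      simp [hω]
  | add g h _ _ hg hh =>
    obtain ⟨C, hC⟩ := hg
    obtain ⟨D, hD⟩ := hh
    refine ⟨C + D, fun f hf => ?_⟩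
    calc ∫⁻ ω, ‖f ω * (g + h) ω‖ₑ ∂μ ≤ ∫⁻ ω, (‖f ω * g ω‖ₑ + ‖f ω * h ω‖ₑ) ∂μ := by
          refine lintegral_mono_ae ?_
          filter_upwards [AEEqFun.coeFn_add g h] with ω hω
          rw [hω, Pi.add_apply, mul_add]
          exact enorm_add_le _ _
      _ = ∫⁻ ω, ‖f ω * g ω‖ₑ ∂μ + ∫⁻ ω, ‖f ω * h ω‖ₑ ∂μ :=
          lintegral_add_left' (f.aestronglyMeasurable.mul g.aestronglyMeasurable).enorm _
      _ ≤ C + D := add_le_add (hC f hf) (hD f hf)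
      _ = ((C + D : NNReal) : ENNReal) := by push_cast; rfl
  | smul c g _ hg =>
    obtain ⟨C, hC⟩ := hg
    refine ⟨‖c‖₊ * C, fun f hf => ?_⟩
    calc ∫⁻ ω, ‖f ω * (c • g) ω‖ₑ ∂μ = ∫⁻ ω, ‖c‖ₑ * ‖f ω * g ω‖ₑ ∂μ := by
          refine lintegral_congr_ae ?_
          filter_upwards [AEEqFun.coeFn_smul c g] with ω hω
          rw [hω, Pi.smul_apply, smul_eq_mul, ← enorm_mul]
          congr 1
          ring
      _ = ‖c‖ₑ * ∫⁻ ω, ‖f ω * g ω‖ₑ ∂μ :=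
          lintegral_const_mul' _ _ enorm_ne_top
      _ ≤ ‖c‖ₑ * C := by
          gcongr
          exact hC f hf
      _ = ((‖c‖₊ * C : NNReal) : ENNReal) := by push_cast; rfl

theorem exists_mem_integral_eq_one {F : Set (Ω →ₘ[μ] ℝ)} (hsub : IsSubspace μ F)
    (hsolid : SolidSet μ F) (hF : ∃ g ∈ F, StrictlyPos μ g) :
    ∃ g ∈ F, StrictlyPos μ g ∧ Integrable g μ ∧ ∫ ω, g ω ∂μ = 1 := by
  obtain ⟨g, hgF, hg⟩ := hF
  set h : Ω →ₘ[μ] ℝ := g ⊓ 1 with hh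
  have hcoe : ∀ᵐ ω ∂μ, 0 < h ω ∧ h ω ≤ g ω ∧ h ω ≤ 1 := by
    filter_upwards [AEEqFun.coeFn_inf g 1, AEEqFun.coeFn_one (μ := μ) (β := ℝ), hg] with ω h1 h2 h3
    rw [hh, h1, h2]
    exact ⟨lt_min h3 one_pos, min_le_left _ _, min_le_right _ _⟩
  have hint : Integrable h μ := by
    refine (integrable_const (1 : ℝ)).mono' h.aestronglyMeasurable ?_
    filter_upwards [hcoe] with ω hω
    rw [Real.norm_of_nonneg hω.1.le]
    exact hω.2.2
  have hpos : 0 < ∫ ω, h ω ∂μ := by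
    rw [integral_pos_iff_support_of_nonneg_ae (hcoe.mono fun ω hω => hω.1.le) hint]
    have hsupp : Function.support h =ᵐ[μ] Set.univ := by
      rw [eventuallyEq_univ]
      exact hcoe.mono fun ω hω => hω.1.ne'
    rw [measure_congr hsupp]
    simp
  have hsmul := AEEqFun.coeFn_smul (∫ ω, h ω ∂μ)⁻¹ h
  refine ⟨(∫ ω, h ω ∂μ)⁻¹ • h, hsub.2.2 _ _ (hsolid g hgF h ?_), ?_, ?_, ?_⟩
  · filter_upwards [hcoe] with ω hω
    rw [abs_of_pos hω.1]
    exact hω.2.1.trans (le_abs_self _)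
  · filter_upwards [hcoe, hsmul] with ω h1 h2
    rw [h2]
    exact mul_pos (inv_pos.2 hpos) h1.1
  · exact (hint.smul _).congr hsmul.symm
  · rw [integral_congr_ae hsmul]
    simp only [Pi.smul_apply, smul_eq_mul]
    rw [integral_const_mul, inv_mul_cancel₀ hpos.ne']

omit [IsProbabilityMeasure μ] in
theorem continuous_pair_of_isEquicontKothe {K : Set (Ω →ₘ[μ] ℝ)} {τ : TopologicalSpace (EK μ K)}
    {F : Set (Ω →ₘ[μ] ℝ)} (hτ : IsEquicontKothe μ K τ F) {g : Ω →ₘ[μ] ℝ} (hg : g ∈ F) :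
    Continuous fun x : {f : EK μ K // (f : Ω →ₘ[μ] ℝ) ∈ K} => pair μ x.1 g := by
  have hK : KBdd μ K {f : EK μ K | (f : Ω →ₘ[μ] ℝ) ∈ K} :=
    ⟨1, one_pos, fun f hf => by simpa using hf⟩
  have htop := hτ.2.2.2.2.2.2 _ hK
  rw [continuous_iff_le_induced]
  refine htop.le.trans ?_
  refine (induced_mono (iInf₂_le g hg)).trans ?_
  rw [induced_compose]
  rfl

omit [IsProbabilityMeasure μ] in
theorem lintegral_enorm_withDensity {f g : Ω →ₘ[μ] ℝ} (hg : StrictlyPos μ g) :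
    ∫⁻ ω, ‖f ω‖ₑ ∂μ.withDensity (fun ω => ENNReal.ofReal (g ω)) = ∫⁻ ω, ‖f ω * g ω‖ₑ ∂μ := by
  rw [lintegral_withDensity_eq_lintegral_mul₀ g.aestronglyMeasurable.aemeasurable.ennreal_ofReal
    f.aestronglyMeasurable.enorm]
  refine lintegral_congr_ae ?_
  filter_upwards [hg] with ω hω
  rw [Pi.mul_apply, enorm_mul, mul_comm, Real.enorm_of_nonneg hω.le]

omit [IsProbabilityMeasure μ] in
theorem setIntegral_withDensity_eq_pair {f g : Ω →ₘ[μ] ℝ} (hg : StrictlyPos μ g) {A : Set Ω}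
    (hA : MeasurableSet A) :
    ∫ ω in A, f ω ∂μ.withDensity (fun ω => ENNReal.ofReal (g ω)) =
      pair μ f (AEEqFun.mk (A.indicator g) (g.aestronglyMeasurable.indicator hA)) := by
  rw [setIntegral_withDensity_eq_setIntegral_toReal_smul₀
    g.aestronglyMeasurable.aemeasurable.ennreal_ofReal.restrict (by simp) _ hA,
    ← integral_indicator hA, pair]
  refine integral_congr_ae ?_
  filter_upwards [hg, AEEqFun.coeFn_mk (A.indicator g) (g.aestronglyMeasurable.indicator hA)]
    with ω h1 h2
  rw [h2]
  by_cases hω : ω ∈ A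
  · simp [hω, ENNReal.toReal_ofReal h1.le, mul_comm]
  · simp [hω]

section Theorems

variable (K : Set (Ω →ₘ[μ] ℝ))

theorem stmt5
    (hconv : Convex ℝ K) (hbal : Balanced ℝ K)
    (hcl : ClosedInProb μ K) (hbdd : BoundedInProb μ K)
    (τ : TopologicalSpace (EK μ K)) (F : Set (Ω →ₘ[μ] ℝ))
    (hτ : IsEquicontKothe μ K τ F) :
    ∃ ν : Measure Ω, IsProbabilityMeasure ν ∧ ν ≪ μ ∧ μ ≪ ν ∧
      (∃ g ∈ F, ν = μ.withDensity (fun ω => ENNReal.ofReal (g ω))) ∧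
      UnifInt μ ν K := by
  obtain ⟨g, hgF, hgpos, hgint, hg1⟩ :=
    exists_mem_integral_eq_one μ hτ.2.2.1 hτ.2.2.2.1 hτ.2.2.2.2.1
  obtain ⟨C, hC⟩ := exists_lintegral_mul_le_of_mem_EK' μ (hτ.2.1 hgF)
  set ν := μ.withDensity fun ω => ENNReal.ofReal (g ω) with hν
  have hνμ : ν ≪ μ := withDensity_absolutelyContinuous _ _
  have hint : ∀ f ∈ K, Integrable f ν := fun f hf =>
    ⟨f.aestronglyMeasurable.mono_ac hνμ,
      (lintegral_enorm_withDensity μ hgpos).trans_lt ((hC f hf).trans_lt ENNReal.coe_lt_top)⟩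
  have : CompactSpace {f : EK μ K // (f : Ω →ₘ[μ] ℝ) ∈ K} :=
    isCompact_iff_compactSpace.1 hτ.1
  have hcont : ∀ A, MeasurableSet A → Continuous
      fun x : {f : EK μ K // (f : Ω →ₘ[μ] ℝ) ∈ K} => ∫ ω in A, (x.1 : Ω →ₘ[μ] ℝ) ω ∂ν := by
    intro A hA
    refine (continuous_pair_of_isEquicontKothe μ hτ (hτ.2.2.2.1 g hgF _ ?_)).congr fun x =>
      (setIntegral_withDensity_eq_pair μ hgpos hA).symm
    filter_upwards [AEEqFun.coeFn_mk (A.indicator g) (g.aestronglyMeasurable.indicator hA)]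
      with ω hω
    rw [hω]
    by_cases h : ω ∈ A <;> simp [h]
  refine ⟨ν, ⟨?_⟩, hνμ, ?_, ⟨g, hgF, rfl⟩, fun ε hε => ?_, C, fun f hf => ?_⟩
  · rw [hν, withDensity_apply _ .univ, Measure.restrict_univ,
      ← ofReal_integral_eq_lintegral_ofReal hgint (hgpos.mono fun ω hω => hω.le), hg1,
      ENNReal.ofReal_one]
  · refine withDensity_absolutelyContinuous' g.aestronglyMeasurable.aemeasurable.ennreal_ofReal ?_
    exact hgpos.mono fun ω hω => (ENNReal.ofReal_pos.2 hω).ne'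
  · obtain ⟨δ, hδ, h⟩ := uniformly_small_setLIntegral ν
      (fun (x : {f : EK μ K // (f : Ω →ₘ[μ] ℝ) ∈ K}) => (x.1 : Ω →ₘ[μ] ℝ))
      (fun x => hint _ x.2) hcont (ENNReal.ofReal_pos.2 hε)
    obtain ⟨r, -, hr0, hr⟩ := ENNReal.lt_iff_exists_real_btwn.1 hδ
    exact ⟨r, ENNReal.ofReal_pos.1 hr0, fun A hA hAr f hf =>
      h A hA (hAr.trans hr) ⟨⟨f, Submodule.subset_span hf⟩, hf⟩⟩
  · rw [ENNReal.ofReal_coe_nnreal]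
    exact (lintegral_enorm_withDensity μ hgpos).trans_le (hC f hf)

end Theorems

end EquicontKothe
end
end

section
/- Suppose there exists a probability measure ν on (Ω, 𝓕) equivalent to μ such that K is uniformly ν-integrable. Then the topology on E_K obtained by restricting the weak topology σ(L¹(ν), L^∞) is an equicontinuous Köthe topology on E_K; it is induced by the subspace F = { ζ · (dν/dμ) : ζ ∈ L^∞(μ) } of E'_K. -/
open MeasureTheory Filter Topology Pointwise

noncomputable section

namespace EquicontKothe

variable {Ω : Type*} [MeasurableSpace Ω] (μ : Measure Ω) [IsProbabilityMeasure μ]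

section Theorems

variable (K : Set (Ω →ₘ[μ] ℝ))

/-- The Radon-Nikodým derivative `dν/dμ` as an element of `L⁰(μ)`. -/
def rnD (ν : Measure Ω) : Ω →ₘ[μ] ℝ :=
  AEEqFun.mk (fun ω => (ν.rnDeriv μ ω).toReal)
    ((Measure.measurable_rnDeriv ν μ).ennreal_toReal.aestronglyMeasurable)

/-- The a.e. bounded elements of `L⁰(μ)`, i.e. `L^∞(μ)`. -/
def boundedAE : Set (Ω →ₘ[μ] ℝ) := {ζ | ∃ C : ℝ, ∀ᵐ ω ∂μ, |ζ ω| ≤ C}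

/-- The subspace `F = {ζ · (dν/dμ) : ζ ∈ L^∞(μ)}`. -/
def FNu (ν : Measure Ω) : Set (Ω →ₘ[μ] ℝ) :=
  {h | ∃ ζ ∈ boundedAE μ, h = ζ * rnD μ ν}

/-- The topology on `E_K` obtained by restricting `σ(L¹(ν), L^∞)`. -/
def tauNu (ν : Measure Ω) : TopologicalSpace (EK μ K) :=
  ⨅ ζ ∈ boundedAE μ, TopologicalSpace.induced
    (fun f : EK μ K => ∫ ω, (f : Ω →ₘ[μ] ℝ) ω * ζ ω ∂ν) inferInstance

theorem exists_integrable_forall_eq_setIntegral {Ω : Type*} [MeasurableSpace Ω] {ν : Measure Ω}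
    [IsFiniteMeasure ν] {m : Set Ω → ℝ}
    (hadd : ∀ A B, MeasurableSet A → MeasurableSet B → Disjoint A B → m (A ∪ B) = m A + m B)
    (hcont : ∀ ε : ℝ, 0 < ε → ∃ δ : ENNReal, 0 < δ ∧
      ∀ A, MeasurableSet A → ν A < δ → |m A| < ε) :
    ∃ g : Ω → ℝ, Integrable g ν ∧ ∀ A, MeasurableSet A → m A = ∫ ω in A, g ω ∂ν := by
  classical
  have hempty : m ∅ = 0 := by
    have := hadd ∅ ∅ .empty .empty (by simp)
    simpa using this
  have hfin : ∀ (A : ℕ → Set Ω), (∀ i, MeasurableSet (A i)) → Pairwise (Function.onFun Disjoint A) →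
      ∀ s : Finset ℕ, m (⋃ i ∈ s, A i) = ∑ i ∈ s, m (A i) := by
    intro A hA hd s
    induction s using Finset.induction_on with
    | empty => simpa using hempty
    | insert a s ha ih =>
      rw [Finset.sum_insert ha, Finset.set_biUnion_insert, hadd _ _ (hA a)
        (s.measurableSet_biUnion fun i _ => hA i), ih]
      refine Set.disjoint_iUnion₂_right.2 fun i hi => hd ?_
      rintro rfl
      exact ha hi
  let s : SignedMeasure Ω :=
    { measureOf' := fun A => if MeasurableSet A then m A else 0
      empty' := by simp [hempty]
      not_measurable' := fun A hA => by simp [hA]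
      m_iUnion' := by
        intro A hA hd
        simp only [hA, MeasurableSet.iUnion hA, if_true]
        rw [HasSum, SummationFilter.unconditional_filter, Metric.tendsto_nhds]
        intro ε hε
        obtain ⟨δ, hδ, h⟩ := hcont ε hε
        have hsum : ∑' i, ν (A i) ≠ ⊤ := by
          rw [← measure_iUnion hd hA]
          exact measure_ne_top _ _
        filter_upwards [(ENNReal.tendsto_tsum_compl_atTop_zero hsum).eventually
          (gt_mem_nhds hδ)] with t ht
        have hmt : MeasurableSet (⋃ i ∈ t, A i) := t.measurableSet_biUnion fun i _ => hA i
        have hmc : MeasurableSet (⋃ i : {i // i ∉ t}, A i) := .iUnion fun i => hA i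
        have hdisj : Disjoint (⋃ i ∈ t, A i) (⋃ i : {i // i ∉ t}, A i) := by
          refine Set.disjoint_iUnion₂_left.2 fun i hi => Set.disjoint_iUnion_right.2 fun j => hd ?_
          rintro rfl
          exact j.2 hi
        have hunion : (⋃ i, A i) = (⋃ i ∈ t, A i) ∪ ⋃ i : {i // i ∉ t}, A i := by
          ext ω
          simp only [Set.mem_iUnion, Set.mem_union, Subtype.exists, exists_prop]
          constructor
          · rintro ⟨i, hi⟩
            by_cases hit : i ∈ t
            exacts [.inl ⟨i, hit, hi⟩, .inr ⟨i, hit, hi⟩]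
          · rintro (⟨i, _, hi⟩ | ⟨i, _, hi⟩) <;> exact ⟨i, hi⟩
        rw [hunion, hadd _ _ hmt hmc hdisj, hfin A hA hd, Real.dist_eq, abs_sub_comm,
          add_sub_cancel_left]
        exact h _ hmc ((measure_iUnion_le _).trans_lt ht) }
  have hs : ∀ A, MeasurableSet A → s A = m A := fun A hA => if_pos hA
  have hac : s ≪ᵥ ν.toENNRealVectorMeasure := by
    refine VectorMeasure.AbsolutelyContinuous.mk fun A hA h0 => ?_
    rw [Measure.toENNRealVectorMeasure_apply_measurable hA] at h0
    rw [hs A hA]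
    by_contra hne
    obtain ⟨δ, hδ, h⟩ := hcont |m A| (abs_pos.2 hne)
    exact (h A hA (h0 ▸ hδ)).false
  refine ⟨s.rnDeriv ν, SignedMeasure.integrable_rnDeriv s ν, fun A hA => ?_⟩
  rw [← withDensityᵥ_apply (SignedMeasure.integrable_rnDeriv s ν) hA,
    (SignedMeasure.absolutelyContinuous_iff_withDensityᵥ_rnDeriv_eq s ν).1 hac, hs A hA]

theorem exists_bounded_density_of_strongDual {Ω : Type*} [MeasurableSpace Ω] {ν : Measure Ω}
    [IsFiniteMeasure ν] (φ : StrongDual ℝ (Lp ℝ 1 ν)) :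
    ∃ h : Ω → ℝ, AEStronglyMeasurable h ν ∧ (∃ C : ℝ, ∀ᵐ ω ∂ν, |h ω| ≤ C) ∧
      ∀ f : Lp ℝ 1 ν, φ f = ∫ ω, f ω * h ω ∂ν := by
  classical
  let m : Set Ω → ℝ := fun A =>
    if hA : MeasurableSet A then φ (indicatorConstLp 1 hA (measure_ne_top ν A) 1) else 0
  have hm : ∀ A (hA : MeasurableSet A),
      m A = φ (indicatorConstLp 1 hA (measure_ne_top ν A) 1) := fun A hA => dif_pos hA
  have hnorm : ∀ A, MeasurableSet A → |m A| ≤ ‖φ‖ * ν.real A := by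
    intro A hA
    rw [hm A hA]
    refine (φ.le_opNorm _).trans_eq ?_
    rw [norm_indicatorConstLp one_ne_zero ENNReal.one_ne_top]
    simp
  obtain ⟨h, hint, hmh⟩ := exists_integrable_forall_eq_setIntegral (ν := ν) (m := m)
    (by
      intro A B hA hB hd
      rw [hm _ (hA.union hB), hm A hA, hm B hB, ← map_add]
      congr 1
      exact indicatorConstLp_disjoint_union hA hB (measure_ne_top _ _) (measure_ne_top _ _) hd 1)
    (by
      intro ε hε
      refine ⟨ENNReal.ofReal (ε / (‖φ‖ + 1)), ENNReal.ofReal_pos.2 (by positivity), ?_⟩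
      intro A hA hlt
      have h1 : ν.real A < ε / (‖φ‖ + 1) := (ENNReal.lt_ofReal_iff_toReal_lt (by finiteness)).1 hlt
      have h2 := hnorm A hA
      rw [lt_div_iff₀ (by positivity)] at h1
      have : 0 ≤ ν.real A := measureReal_nonneg
      nlinarith)
  have hle : ∀ᵐ ω ∂ν, |h ω| ≤ ‖φ‖ := by
    have h1 : h ≤ᵐ[ν] fun _ => ‖φ‖ :=
      ae_le_of_forall_setIntegral_le hint (integrable_const _) fun A hA _ => by
        rw [← hmh A hA, setIntegral_const, smul_eq_mul, mul_comm]
        exact (le_abs_self _).trans (hnorm A hA)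
    have h2 : (fun _ => -‖φ‖) ≤ᵐ[ν] h :=
      ae_le_of_forall_setIntegral_le (integrable_const _) hint fun A hA _ => by
        rw [← hmh A hA, setIntegral_const, smul_eq_mul, mul_neg, mul_comm]
        exact neg_le_of_abs_le (hnorm A hA)
    filter_upwards [h1, h2] with ω h1 h2 using abs_le.2 ⟨h2, h1⟩
  have hmem : MemLp h ⊤ ν := memLp_top_of_bound hint.aestronglyMeasurable ‖φ‖ hle
  have hφ : φ = ((ContinuousLinearMap.mul ℝ ℝ).lpPairing ν 1 ⊤).flip (hmem.toLp h) := by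
    refine ContinuousLinearMap.ext fun f => ?_
    induction f using Lp.induction ENNReal.one_ne_top with
    | @indicatorConst c A hA hμA =>
      rw [Lp.simpleFunc.coe_indicatorConst]
      have hc : indicatorConstLp 1 hA hμA.ne c = c • indicatorConstLp 1 hA hμA.ne (1 : ℝ) := by
        refine Lp.ext ?_
        filter_upwards [indicatorConstLp_coeFn (p := 1) (hs := hA) (hμs := hμA.ne) (c := c),
          indicatorConstLp_coeFn (p := 1) (hs := hA) (hμs := hμA.ne) (c := (1 : ℝ)),
          Lp.coeFn_smul c (indicatorConstLp 1 hA hμA.ne (1 : ℝ))] with ω h1 h2 h3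
        rw [h1, h3, Pi.smul_apply, h2]
        by_cases hω : ω ∈ A <;> simp [hω]
      rw [hc, map_smul, map_smul, ← hm A hA, hmh A hA, ContinuousLinearMap.flip_apply,
        ContinuousLinearMap.lpPairing_eq_integral, ← integral_indicator hA]
      congr 1
      refine integral_congr_ae ?_
      filter_upwards [indicatorConstLp_coeFn (p := 1) (hs := hA) (hμs := hμA.ne) (c := (1 : ℝ)),
        hmem.coeFn_toLp] with ω h1 h2
      rw [h1, h2]
      by_cases hω : ω ∈ A <;> simp [hω]
    | add hf hg hd ihf ihg => rw [map_add, map_add, ihf, ihg]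
    | isClosed => exact isClosed_eq φ.continuous (ContinuousLinearMap.continuous _)
  refine ⟨h, hint.aestronglyMeasurable, ⟨_, hle⟩, fun f => ?_⟩
  rw [hφ, ContinuousLinearMap.flip_apply, ContinuousLinearMap.lpPairing_eq_integral]
  refine integral_congr_ae ?_
  filter_upwards [hmem.coeFn_toLp] with ω hω
  simp [hω]

theorem exists_simpleFunc_abs_sub_le {Ω : Type*} [MeasurableSpace Ω] {ν : Measure Ω} {ζ : Ω → ℝ}
    (hζ : AEStronglyMeasurable ζ ν) {M : ℝ} (hM : ∀ᵐ ω ∂ν, |ζ ω| ≤ M) {ε : ℝ} (hε : 0 < ε) :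
    ∃ φ : SimpleFunc Ω ℝ, ∀ᵐ ω ∂ν, |ζ ω - φ ω| ≤ ε := by
  let z : Ω → ℤ := fun ω => ⌊max (-M) (min M (hζ.mk ζ ω)) / ε⌋
  have hz : Measurable z :=
    ((measurable_const.max (measurable_const.min hζ.stronglyMeasurable_mk.measurable)).div_const
      ε).floor
  have hfin : (Set.range z).Finite := by
    refine (Set.finite_Icc ⌊(-M) / ε⌋ ⌊max (-M) M / ε⌋).subset ?_
    rintro _ ⟨ω, rfl⟩
    exact ⟨Int.floor_mono (by gcongr; exact le_max_left _ _),
      Int.floor_mono (by gcongr; exact min_le_left _ _)⟩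
  let ψ : SimpleFunc Ω ℤ := ⟨z, fun x => hz (measurableSet_singleton x), hfin⟩
  refine ⟨ψ.map fun k : ℤ => (k : ℝ) * ε, ?_⟩
  filter_upwards [hM, hζ.ae_eq_mk] with ω hω hmk
  obtain ⟨h1, h2⟩ := abs_le.1 hω
  have hzω : z ω = ⌊ζ ω / ε⌋ := by
    simp only [z]
    rw [← hmk, min_eq_right h2, max_eq_right h1]
  have hval : (ψ.map fun k : ℤ => (k : ℝ) * ε) ω = (⌊ζ ω / ε⌋ : ℝ) * ε := by
    rw [SimpleFunc.map_apply, ← hzω]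
    rfl
  have h3 := (le_div_iff₀ hε).1 (Int.floor_le (ζ ω / ε))
  have h4 := (div_lt_iff₀ hε).1 (Int.lt_floor_add_one (ζ ω / ε))
  rw [hval, abs_le]
  constructor <;> linarith

theorem abs_integral_mul_sub_le {Ω : Type*} [MeasurableSpace Ω] {ν : Measure Ω} {f ζ φ : Ω → ℝ}
    (hf : Integrable f ν) (hζ : Integrable (fun ω => f ω * ζ ω) ν)
    (hφ : Integrable (fun ω => f ω * φ ω) ν) {ε : ℝ} (h : ∀ᵐ ω ∂ν, |ζ ω - φ ω| ≤ ε) :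
    |∫ ω, f ω * ζ ω ∂ν - ∫ ω, f ω * φ ω ∂ν| ≤ (∫ ω, |f ω| ∂ν) * ε := by
  rw [← integral_sub hζ hφ, ← integral_mul_const]
  refine (abs_integral_le_integral_abs).trans
    (integral_mono_ae (hζ.sub hφ).abs (hf.abs.mul_const ε) ?_)
  filter_upwards [h] with ω hω
  simp only [← mul_sub, abs_mul]
  gcongr

theorem exists_weak_limit_of_ultrafilter {Ω ι : Type*} [MeasurableSpace Ω] {ν : Measure Ω}
    [IsFiniteMeasure ν] (U : Ultrafilter ι) {s : Set ι} (hs : s ∈ U) {f : ι → Ω → ℝ}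
    (hf : ∀ i ∈ s, Integrable (f i) ν) {C : ℝ} (hC : ∀ i ∈ s, ∫ ω, |f i ω| ∂ν ≤ C)
    (hui : ∀ ε : ℝ, 0 < ε → ∃ δ : ENNReal, 0 < δ ∧ ∀ A, MeasurableSet A → ν A < δ →
      ∀ i ∈ s, ∫ ω in A, |f i ω| ∂ν ≤ ε) :
    ∃ g : Ω → ℝ, Integrable g ν ∧ ∀ ζ : Ω → ℝ, AEStronglyMeasurable ζ ν →
      (∃ M : ℝ, ∀ᵐ ω ∂ν, |ζ ω| ≤ M) →
      Tendsto (fun i => ∫ ω, f i ω * ζ ω ∂ν) U (𝓝 (∫ ω, g ω * ζ ω ∂ν)) := by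
  have hlim : ∀ A : Set Ω, ∃ l : ℝ, Tendsto (fun i => ∫ ω in A, f i ω ∂ν) U (𝓝 l) := by
    intro A
    obtain ⟨l, -, hl⟩ := (isCompact_Icc (a := -C) (b := C)).ultrafilter_le_nhds
      (U.map fun i => ∫ ω in A, f i ω ∂ν) (by
        rw [le_principal_iff]
        refine mem_map.2 (mem_of_superset hs fun i hi => ?_)
        exact abs_le.1 (abs_integral_le_integral_abs.trans
          ((setIntegral_le_integral (hf i hi).abs (ae_of_all _ fun _ => abs_nonneg _)).trans
            (hC i hi))))
    exact ⟨l, hl⟩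
  choose m hm using hlim
  obtain ⟨g, hg, hmg⟩ := exists_integrable_forall_eq_setIntegral (ν := ν) (m := m)
    (by
      intro A B hA hB hd
      refine tendsto_nhds_unique (hm (A ∪ B)) (((hm A).add (hm B)).congr' ?_)
      filter_upwards [hs] with i hi
      exact (setIntegral_union hd hB (hf i hi).integrableOn (hf i hi).integrableOn).symm)
    (by
      intro ε hε
      obtain ⟨δ, hδ, h⟩ := hui (ε / 2) (half_pos hε)
      refine ⟨δ, hδ, fun A hA hlt => lt_of_le_of_lt ?_ (half_lt_self hε)⟩
      refine le_of_tendsto (hm A).abs ?_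
      filter_upwards [hs] with i hi
      exact abs_integral_le_integral_abs.trans (h A hA hlt i hi))
  have hmul : ∀ {u : Ω → ℝ}, Integrable u ν → ∀ φ : SimpleFunc Ω ℝ,
      Integrable (fun ω => u ω * φ ω) ν := by
    intro u hu φ
    obtain ⟨M, hM⟩ := φ.exists_forall_norm_le
    exact hu.mul_bdd (c := M) φ.aestronglyMeasurable (ae_of_all _ hM)
  have hsimple : ∀ φ : SimpleFunc Ω ℝ,
      Tendsto (fun i => ∫ ω, f i ω * φ ω ∂ν) U (𝓝 (∫ ω, g ω * φ ω ∂ν)) := by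
    intro φ
    induction φ using SimpleFunc.induction with
    | const c hA =>
      rename_i A
      have h : ∀ u : Ω → ℝ, ∫ ω, u ω * (SimpleFunc.piecewise A hA (SimpleFunc.const Ω c)
          (SimpleFunc.const Ω 0)) ω ∂ν = (∫ ω in A, u ω ∂ν) * c := by
        intro u
        rw [← integral_mul_const, ← integral_indicator hA]
        congr 1 with ω
        by_cases hω : ω ∈ A <;> simp [hω]
      simp only [h, ← hmg A hA]
      exact (hm A).mul_const c
    | add hd ih₁ ih₂ =>
      rename_i φ ψ
      simp only [SimpleFunc.coe_add, Pi.add_apply, mul_add]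
      rw [integral_add (hmul hg φ) (hmul hg ψ)]
      refine (ih₁.add ih₂).congr' ?_
      filter_upwards [hs] with i hi
      exact (integral_add (hmul (hf i hi) φ) (hmul (hf i hi) ψ)).symm
  refine ⟨g, hg, fun ζ hζ ⟨M, hM⟩ => Metric.tendsto_nhds.2 fun ε hε => ?_⟩
  have hG : 0 ≤ ∫ ω, |g ω| ∂ν := integral_nonneg fun _ => abs_nonneg _
  set G := ∫ ω, |g ω| ∂ν
  obtain ⟨η, hη, hηε⟩ : ∃ η : ℝ, 0 < η ∧ (|C| + G) * η < ε / 2 := by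
    refine ⟨ε / (2 * (|C| + G + 1)), by positivity, ?_⟩
    rw [mul_div_assoc', div_lt_div_iff₀ (by positivity) (by positivity)]
    nlinarith [abs_nonneg C]
  obtain ⟨φ, hφ⟩ := exists_simpleFunc_abs_sub_le hζ hM hη
  filter_upwards [hs, Metric.tendsto_nhds.1 (hsimple φ) (ε / 2) (half_pos hε)] with i hi hlt
  have h1 := abs_le.1 (abs_integral_mul_sub_le (hf i hi) ((hf i hi).mul_bdd (c := M) hζ hM)
    (hmul (hf i hi) φ) hφ)
  have h2 := abs_le.1 (abs_integral_mul_sub_le hg (hg.mul_bdd (c := M) hζ hM) (hmul hg φ) hφ)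
  have h3 : (∫ ω, |f i ω| ∂ν) * η ≤ |C| * η := by
    gcongr
    exact (hC i hi).trans (le_abs_self C)
  rw [Real.dist_eq, abs_lt] at hlt ⊢
  constructor <;> linarith [h1.1, h1.2, h2.1, h2.2, hlt.1, hlt.2]

section Auxiliary

variable {μ K} {ν : Measure Ω}

theorem aestronglyMeasurable_coeFn_of_absolutelyContinuous {μ ν : Measure Ω} (hνμ : ν ≪ μ) (f : Ω →ₘ[μ] ℝ) :
    AEStronglyMeasurable f ν :=
  f.aestronglyMeasurable.mono_ac hνμ

theorem UnifInt.integrable {μ ν : Measure Ω} {K : Set (Ω →ₘ[μ] ℝ)} (hui : UnifInt μ ν K) (hνμ : ν ≪ μ)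
    {f : Ω →ₘ[μ] ℝ} (hf : f ∈ K) : Integrable f ν := by
  obtain ⟨C, hC⟩ := hui.2
  exact ⟨aestronglyMeasurable_coeFn_of_absolutelyContinuous hνμ f,
    (hC f hf).trans_lt ENNReal.ofReal_lt_top⟩

theorem UnifInt.integrable_of_mem_EK {μ ν : Measure Ω} {K : Set (Ω →ₘ[μ] ℝ)}
    (hui : UnifInt μ ν K) (hνμ : ν ≪ μ) {f : Ω →ₘ[μ] ℝ} (hf : f ∈ EK μ K) : Integrable f ν := by
  induction hf using Submodule.span_induction with
  | mem f hf => exact hui.integrable hνμ hf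
  | zero =>
    exact (integrable_zero Ω ℝ ν).congr (hνμ.ae_eq (AEEqFun.coeFn_zero (μ := μ) (β := ℝ)).symm)
  | add f g _ _ hf hg => exact (hf.add hg).congr (hνμ.ae_eq (AEEqFun.coeFn_add f g).symm)
  | smul a f _ hf => exact (hf.smul a).congr (hνμ.ae_eq (AEEqFun.coeFn_smul a f).symm)

theorem coeFn_rnD (μ ν : Measure Ω) [IsProbabilityMeasure μ] :
    rnD μ ν =ᵐ[μ] fun ω => (ν.rnDeriv μ ω).toReal :=
  AEEqFun.coeFn_mk _ _

theorem strictlyPos_rnD [SigmaFinite ν] (hμν : μ ≪ ν) : StrictlyPos μ (rnD μ ν) := by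
  filter_upwards [coeFn_rnD μ ν, Measure.rnDeriv_pos' hμν, ν.rnDeriv_ne_top μ] with ω h h0 hT
  rw [h]
  exact ENNReal.toReal_pos h0.ne' hT

theorem pair_mul_rnD [SigmaFinite ν] (hνμ : ν ≪ μ) (f ζ : Ω →ₘ[μ] ℝ) :
    pair μ f (ζ * rnD μ ν) = ∫ ω, f ω * ζ ω ∂ν := by
  rw [pair, ← integral_toReal_rnDeriv_mul hνμ]
  refine integral_congr_ae ?_
  filter_upwards [coeFn_rnD μ ν, AEEqFun.coeFn_mul ζ (rnD μ ν)] with ω h1 h2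
  rw [h2, Pi.mul_apply, h1]
  ring

theorem weakTop_FNu_eq_tauNu [SigmaFinite ν] (hνμ : ν ≪ μ) :
    weakTop μ (EK μ K) (FNu μ ν) = tauNu μ K ν := by
  refine le_antisymm (le_iInf₂ fun ζ hζ => ?_) (le_iInf₂ fun g hg => ?_)
  · refine (iInf₂_le (ζ * rnD μ ν) ⟨ζ, hζ, rfl⟩).trans_eq ?_
    simp only [pair_mul_rnD hνμ]
  · obtain ⟨ζ, hζ, rfl⟩ := hg
    simp only [pair_mul_rnD hνμ]
    exact iInf₂_le ζ hζ

theorem isSubspace_FNu (μ ν : Measure Ω) [IsProbabilityMeasure μ] :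
    IsSubspace μ (FNu μ ν) := by
  refine ⟨⟨0, ⟨0, ?_⟩, AEEqFun.ext ?_⟩, ?_, ?_⟩
  · filter_upwards [AEEqFun.coeFn_zero (μ := μ) (β := ℝ)] with ω h
    simp [h]
  · filter_upwards [AEEqFun.coeFn_zero (μ := μ) (β := ℝ),
      AEEqFun.coeFn_mul 0 (rnD μ ν)] with ω h1 h2
    simp [h1, h2]
  · rintro _ ⟨ζ, ⟨C, hC⟩, rfl⟩ _ ⟨η, ⟨D, hD⟩, rfl⟩
    refine ⟨ζ + η, ⟨C + D, ?_⟩, AEEqFun.ext ?_⟩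
    · filter_upwards [hC, hD, AEEqFun.coeFn_add ζ η] with ω h1 h2 h3
      rw [h3, Pi.add_apply]
      exact (abs_add_le _ _).trans (add_le_add h1 h2)
    · filter_upwards [AEEqFun.coeFn_add (ζ * rnD μ ν) (η * rnD μ ν), AEEqFun.coeFn_add ζ η,
        AEEqFun.coeFn_mul ζ (rnD μ ν), AEEqFun.coeFn_mul η (rnD μ ν),
        AEEqFun.coeFn_mul (ζ + η) (rnD μ ν)] with ω h1 h2 h3 h4 h5
      simp only [h1, h2, h3, h4, h5, Pi.add_apply, Pi.mul_apply, add_mul]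
  · rintro a _ ⟨ζ, ⟨C, hC⟩, rfl⟩
    refine ⟨a • ζ, ⟨|a| * C, ?_⟩, AEEqFun.ext ?_⟩
    · filter_upwards [hC, AEEqFun.coeFn_smul a ζ] with ω h1 h2
      rw [h2, Pi.smul_apply, smul_eq_mul, abs_mul]
      gcongr
    · filter_upwards [AEEqFun.coeFn_smul a (ζ * rnD μ ν), AEEqFun.coeFn_smul a ζ,
        AEEqFun.coeFn_mul ζ (rnD μ ν), AEEqFun.coeFn_mul (a • ζ) (rnD μ ν)] with ω h1 h2 h3 h4
      simp only [h1, h2, h3, h4, Pi.smul_apply, Pi.mul_apply, smul_eq_mul, mul_assoc]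

theorem solidSet_FNu [SigmaFinite ν] (hμν : μ ≪ ν) : SolidSet μ (FNu μ ν) := by
  rintro _ ⟨ζ, ⟨C, hC⟩, rfl⟩ h hh
  have hmeas : AEStronglyMeasurable (fun ω => h ω / rnD μ ν ω) μ :=
    (h.aemeasurable.div (rnD μ ν).aemeasurable).aestronglyMeasurable
  have hpos := strictlyPos_rnD hμν
  refine ⟨AEEqFun.mk _ hmeas, ⟨C, ?_⟩, AEEqFun.ext ?_⟩
  · filter_upwards [AEEqFun.coeFn_mk _ hmeas, hpos, hC, hh,
      AEEqFun.coeFn_mul ζ (rnD μ ν)] with ω h1 h2 h3 h4 h5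
    rw [h1, abs_div, abs_of_pos h2, div_le_iff₀ h2]
    rw [h5, Pi.mul_apply, abs_mul, abs_of_pos h2] at h4
    exact h4.trans (by gcongr)
  · filter_upwards [AEEqFun.coeFn_mk _ hmeas, hpos,
      AEEqFun.coeFn_mul (AEEqFun.mk _ hmeas) (rnD μ ν)] with ω h1 h2 h3
    rw [h3, Pi.mul_apply, h1, div_mul_cancel₀ _ h2.ne']

theorem FNu_subset_EK' [SigmaFinite ν] (hνμ : ν ≪ μ) (hui : UnifInt μ ν K) :
    FNu μ ν ⊆ (EK' μ K : Set (Ω →ₘ[μ] ℝ)) := by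
  rintro _ ⟨ζ, ⟨M, hM⟩, rfl⟩
  obtain ⟨C, hC⟩ := hui.2
  obtain ⟨a, ha, hle⟩ : ∃ a : ℝ, 0 < a ∧ a * |M| * |C| ≤ 1 := by
    refine ⟨1 / (|M| * |C| + 1), by positivity, ?_⟩
    rw [mul_assoc, one_div_mul_eq_div, div_le_one (by positivity)]
    linarith
  have hpol : a • (ζ * rnD μ ν) ∈ polar μ K := by
    intro f hf
    calc ∫⁻ ω, (‖f ω * (a • (ζ * rnD μ ν)) ω‖₊ : ENNReal) ∂μ
        = ∫⁻ ω, ν.rnDeriv μ ω * ‖f ω * (a * ζ ω)‖ₑ ∂μ := by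
          refine lintegral_congr_ae ?_
          filter_upwards [coeFn_rnD μ ν, AEEqFun.coeFn_mul ζ (rnD μ ν),
            AEEqFun.coeFn_smul a (ζ * rnD μ ν), ν.rnDeriv_ne_top μ] with ω h1 h2 h3 h4
          rw [h3, Pi.smul_apply, h2, Pi.mul_apply, h1, smul_eq_mul, ← mul_assoc a, ← mul_assoc,
            mul_comm _ (ENNReal.toReal _)]
          change ‖(_ : ℝ)‖ₑ = _
          rw [enorm_mul, Real.enorm_of_nonneg ENNReal.toReal_nonneg, ENNReal.ofReal_toReal h4]
      _ = ∫⁻ ω, ‖f ω * (a * ζ ω)‖ₑ ∂ν :=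
          lintegral_rnDeriv_mul hνμ
            (f.aemeasurable.mul (ζ.aemeasurable.const_mul a)).enorm
      _ ≤ ∫⁻ ω, ENNReal.ofReal (a * |M|) * ‖f ω‖ₑ ∂ν := by
          refine lintegral_mono_ae ?_
          filter_upwards [hνμ.ae_le hM] with ω hω
          rw [enorm_mul, mul_comm]
          gcongr
          rw [Real.enorm_eq_ofReal_abs, abs_mul, abs_of_pos ha]
          exact ENNReal.ofReal_le_ofReal
            (mul_le_mul_of_nonneg_left (hω.trans (le_abs_self M)) ha.le)
      _ = ENNReal.ofReal (a * |M|) * ∫⁻ ω, ‖f ω‖ₑ ∂ν :=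
          lintegral_const_mul' _ _ ENNReal.ofReal_ne_top
      _ ≤ ENNReal.ofReal (a * |M|) * ENNReal.ofReal |C| := by
          gcongr
          exact (hC f hf).trans (ENNReal.ofReal_le_ofReal (le_abs_self C))
      _ ≤ 1 := by
          rw [← ENNReal.ofReal_mul (by positivity)]
          exact ENNReal.ofReal_le_one.2 hle
  rw [← inv_smul_smul₀ ha.ne' (ζ * rnD μ ν)]
  exact Submodule.smul_mem _ _ (Submodule.subset_span hpol)

theorem separates_FNu [SigmaFinite ν] (hνμ : ν ≪ μ) (hμν : μ ≪ ν) (hui : UnifInt μ ν K) :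
    Separates μ (FNu μ ν) (EK μ K) := by
  intro f hf hne
  have hmeas : AEStronglyMeasurable (fun ω => if 0 ≤ f ω then (1 : ℝ) else -1) μ :=
    ((measurable_const.ite measurableSet_Ici measurable_const).comp_aemeasurable
      f.aemeasurable).aestronglyMeasurable
  refine ⟨AEEqFun.mk _ hmeas * rnD μ ν, ⟨_, ⟨1, ?_⟩, rfl⟩, ?_⟩
  · filter_upwards [AEEqFun.coeFn_mk _ hmeas] with ω h
    rw [h]
    split_ifs <;> simp
  · rw [pair_mul_rnD hνμ]
    have h1 : ∫ ω, f ω * (AEEqFun.mk _ hmeas : Ω →ₘ[μ] ℝ) ω ∂ν = ∫ ω, |f ω| ∂ν := by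
      refine integral_congr_ae ?_
      filter_upwards [hνμ.ae_le (AEEqFun.coeFn_mk _ hmeas)] with ω h
      rw [h]
      split_ifs with h0
      · rw [mul_one, abs_of_nonneg h0]
      · rw [mul_neg_one, abs_of_neg (not_le.1 h0)]
    rw [h1]
    intro h0
    rw [integral_eq_zero_iff_of_nonneg (fun _ => abs_nonneg _)
      (hui.integrable_of_mem_EK hνμ hf).abs] at h0
    refine hne (AEEqFun.ext ?_)
    filter_upwards [hμν.ae_le h0, AEEqFun.coeFn_zero (μ := μ) (β := ℝ)] with ω h2 h3
    rw [h3]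
    exact abs_eq_zero.1 h2

theorem isClosed_setOf_exists_mem_ae_eq (hcl : ClosedInProb μ K) (hμν : μ ≪ ν) (hνμ : ν ≪ μ) :
    IsClosed {h : Lp ℝ 1 ν | ∃ f ∈ K, h =ᵐ[ν] f} := by
  refine IsSeqClosed.isClosed fun h g hh hg => ?_
  obtain ⟨n, -, hn⟩ := (tendstoInMeasure_of_tendsto_Lp hg).exists_seq_tendsto_ae
  choose f hfK hf using hh
  have hgμ : AEStronglyMeasurable g μ := (Lp.aestronglyMeasurable g).mono_ac hμν
  refine ⟨AEEqFun.mk g hgμ, hcl (fun i => f (n i)) (fun i => hfK _) _ ?_,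
    (hνμ.ae_eq (AEEqFun.coeFn_mk g hgμ)).symm⟩
  refine tendstoInMeasure_of_tendsto_ae (fun i => (f (n i)).aestronglyMeasurable) ?_
  filter_upwards [hμν.ae_le hn, AEEqFun.coeFn_mk g hgμ,
    ae_all_iff.2 fun i => hμν.ae_eq (hf (n i))] with ω h1 h2 h3
  rw [h2]
  exact h1.congr h3

theorem convex_setOf_exists_mem_ae_eq {μ ν : Measure Ω} {K : Set (Ω →ₘ[μ] ℝ)}
    (hconv : Convex ℝ K) (hνμ : ν ≪ μ) :
    Convex ℝ {h : Lp ℝ 1 ν | ∃ f ∈ K, h =ᵐ[ν] f} := by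
  rintro h ⟨f, hf, hhf⟩ k ⟨g, hg, hkg⟩ a b ha hb hab
  refine ⟨a • f + b • g, hconv hf hg ha hb hab, ?_⟩
  filter_upwards [hhf, hkg, Lp.coeFn_add (a • h) (b • k), Lp.coeFn_smul a h, Lp.coeFn_smul b k,
    hνμ.ae_le (AEEqFun.coeFn_add (a • f) (b • g)), hνμ.ae_le (AEEqFun.coeFn_smul a f),
    hνμ.ae_le (AEEqFun.coeFn_smul b g)] with ω h1 h2 h3 h4 h5 h6 h7 h8
  simp only [h1, h2, h3, h4, h5, h6, h7, h8, Pi.add_apply, Pi.smul_apply]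

theorem isCompact_tauNu [IsFiniteMeasure ν] (hconv : Convex ℝ K) (hcl : ClosedInProb μ K)
    (hνμ : ν ≪ μ) (hμν : μ ≪ ν) (hui : UnifInt μ ν K) :
    @IsCompact _ (tauNu μ K ν) {f : EK μ K | (f : Ω →ₘ[μ] ℝ) ∈ K} := by
  let := tauNu μ K ν
  refine isCompact_iff_ultrafilter_le_nhds'.2 fun U hU => ?_
  have hint : ∀ f : EK μ K, (f : Ω →ₘ[μ] ℝ) ∈ K → Integrable (f : Ω →ₘ[μ] ℝ) ν :=
    fun f hf => hui.integrable hνμ hf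
  obtain ⟨C, hC⟩ := hui.2
  obtain ⟨g, hg, hlim⟩ := exists_weak_limit_of_ultrafilter (ν := ν) U hU
    (f := fun f => ((f : Ω →ₘ[μ] ℝ) : Ω → ℝ)) hint (C := (ENNReal.ofReal C).toReal)
    (by
      intro f hf
      change ∫ ω, ‖(f : Ω →ₘ[μ] ℝ) ω‖ ∂ν ≤ _
      rw [integral_norm_eq_lintegral_enorm (hint f hf).aestronglyMeasurable]
      exact ENNReal.toReal_mono ENNReal.ofReal_ne_top (hC f hf))
    (by
      intro ε hε
      obtain ⟨δ, hδ, h⟩ := hui.1 ε hε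
      refine ⟨ENNReal.ofReal δ, ENNReal.ofReal_pos.2 hδ, fun A hA hlt f hf => ?_⟩
      change ∫ ω in A, ‖(f : Ω →ₘ[μ] ℝ) ω‖ ∂ν ≤ _
      rw [integral_norm_eq_lintegral_enorm (hint f hf).aestronglyMeasurable.restrict]
      exact ENNReal.toReal_le_of_le_ofReal hε.le (h A hA hlt f hf).le)
  have hgK : hg.toL1 g ∈ {h : Lp ℝ 1 ν | ∃ f ∈ K, h =ᵐ[ν] f} := by
    by_contra hnot
    obtain ⟨φ, u, hlt, hgt⟩ := geometric_hahn_banach_closed_point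
      (convex_setOf_exists_mem_ae_eq hconv hνμ)
      (isClosed_setOf_exists_mem_ae_eq hcl hμν hνμ) hnot
    obtain ⟨ζ, hζ, hM, hφ⟩ := exists_bounded_density_of_strongDual φ
    have hφ' : ∀ {f : Ω → ℝ} (hf : Integrable f ν), φ (hf.toL1 f) = ∫ ω, f ω * ζ ω ∂ν := by
      intro f hf
      rw [hφ]
      refine integral_congr_ae ?_
      filter_upwards [hf.coeFn_toL1] with ω hω
      rw [hω]
    rw [hφ' hg] at hgt
    refine hgt.not_ge (le_of_tendsto (hlim ζ hζ hM) ?_)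
    filter_upwards [hU] with f hf
    rw [← hφ' (hint f hf)]
    exact (hlt _ ⟨f, hf, (hint f hf).coeFn_toL1⟩).le
  obtain ⟨f, hfK, hgf⟩ := hgK
  refine ⟨⟨f, Submodule.subset_span hfK⟩, hfK, ?_⟩
  rw [tauNu]
  simp only [nhds_iInf, nhds_induced, le_iInf_iff, ← tendsto_iff_comap]
  rintro ζ ⟨M, hM⟩
  have := hlim ζ (aestronglyMeasurable_coeFn_of_absolutelyContinuous hνμ ζ) ⟨M, hνμ.ae_le hM⟩
  convert this using 2
  refine integral_congr_ae ?_
  filter_upwards [hgf, hg.coeFn_toL1] with ω h1 h2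
  rw [← h2, h1]

theorem one_mem_boundedAE (μ : Measure Ω) [IsProbabilityMeasure μ] :
    (1 : Ω →ₘ[μ] ℝ) ∈ boundedAE μ := by
  refine ⟨1, ?_⟩
  filter_upwards [AEEqFun.coeFn_one (μ := μ) (β := ℝ)] with ω h
  simp [h]

end Auxiliary

theorem stmt6
    (hconv : Convex ℝ K) (hbal : Balanced ℝ K)
    (hcl : ClosedInProb μ K) (hbdd : BoundedInProb μ K)
    (ν : Measure Ω) (hν : IsProbabilityMeasure ν) (hνμ : ν ≪ μ) (hμν : μ ≪ ν)
    (hui : UnifInt μ ν K) :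
    IsEquicontKothe μ K (tauNu μ K ν) (FNu μ ν) := by
  rw [← weakTop_FNu_eq_tauNu hνμ]
  refine ⟨?_, FNu_subset_EK' hνμ hui, isSubspace_FNu μ ν, solidSet_FNu hμν,
    ⟨rnD μ ν, ⟨1, one_mem_boundedAE μ, (one_mul _).symm⟩, strictlyPos_rnD hμν⟩,
    separates_FNu hνμ hμν hui, fun _ _ => rfl⟩
  rw [weakTop_FNu_eq_tauNu hνμ]
  exact isCompact_tauNu hconv hcl hνμ hμν hui

end Theorems

end EquicontKothe
end
end

section
/- A convex and proper function φ : E_K → (-∞, ∞] has the equicontinuous Fatou property if and only if for every λ ∈ ℝ and every ε > 0 the set {f ∈ E_K : φ(f) ≤ λ} ∩ εK is closed in probability. -/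
open MeasureTheory Filter Topology Pointwise

noncomputable section

namespace EquicontKothe

variable {Ω : Type*} [MeasurableSpace Ω] (μ : Measure Ω) [IsProbabilityMeasure μ]

/-- Convergence in probability is preserved by scalar multiplication. -/
theorem TendstoInProb.const_smul {f : ℕ → Ω →ₘ[μ] ℝ} {g : Ω →ₘ[μ] ℝ}
    (h : TendstoInProb μ f g) (c : ℝ) : TendstoInProb μ (fun n => c • f n) (c • g) := by
  have hc : TendstoInMeasure μ (fun n => c • ⇑(f n)) atTop (c • ⇑g) := by
    rcases eq_or_ne c 0 with rfl | hc
    · intro ε hε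
      simp [hε.not_ge]
    · rw [TendstoInProb, tendstoInMeasure_iff_norm] at h
      rw [tendstoInMeasure_iff_norm]
      intro ε hε
      convert h (ε / |c|) (div_pos hε (abs_pos.2 hc)) using 4 with n
      ext ω
      simp only [Pi.smul_apply, ← smul_sub, norm_smul, Real.norm_eq_abs]
      rw [div_le_iff₀' (abs_pos.2 hc)]
  exact hc.congr (fun n => (AEEqFun.coeFn_smul c (f n)).symm) (AEEqFun.coeFn_smul c g).symm

/-- Nonzero multiples of a set closed in probability are closed in probability. -/
theorem ClosedInProb.smul {C : Set (Ω →ₘ[μ] ℝ)} (hC : ClosedInProb μ C) {c : ℝ} (hc : c ≠ 0) :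
    ClosedInProb μ (c • C) := by
  intro f hf g hg
  rw [Set.mem_smul_set_iff_inv_smul_mem₀ hc]
  exact hC _ (fun n => (Set.mem_smul_set_iff_inv_smul_mem₀ hc _ _).1 (hf n)) _
    (TendstoInProb.const_smul μ hg c⁻¹)

/-- Multiples of `K` lie in the span of `K`. -/
theorem smul_subset_EK (K : Set (Ω →ₘ[μ] ℝ)) (c : ℝ) :
    c • K ⊆ (EK μ K : Set (Ω →ₘ[μ] ℝ)) := by
  rintro _ ⟨f, hf, rfl⟩
  exact (EK μ K).smul_mem c (Submodule.subset_span hf)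

section Theorems

variable (K : Set (Ω →ₘ[μ] ℝ))

theorem stmt9
    (hconv : Convex ℝ K) (hbal : Balanced ℝ K)
    (hcl : ClosedInProb μ K) (hbdd : BoundedInProb μ K)
    (φ : EK μ K → EReal) (hφc : ConvexFn φ) (hφp : ProperFn φ) :
    EquicontFatou μ K φ ↔
      ∀ lam ε : ℝ, 0 < ε →
        ClosedInProb μ
          ({f | ∃ hf : f ∈ EK μ K, φ ⟨f, hf⟩ ≤ (lam : EReal)} ∩ ε • K) := by
  constructor
  · intro hF lam ε hε f hf g hg
    have hgK : g ∈ ε • K := hcl.smul μ hε.ne' f (fun n => (hf n).2) g hg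
    choose hE hle using fun n => (hf n).1
    refine ⟨⟨smul_subset_EK μ K ε hgK, ?_⟩, hgK⟩
    refine (hF (fun n => ⟨f n, hE n⟩) ⟨g, _⟩ ⟨ε, hε, fun n => (hf n).2⟩ hg).trans ?_
    exact liminf_le_of_le (by isBoundedDefault) fun b hb =>
      let ⟨n, hn⟩ := hb.exists
      hn.trans (hle n)
  · rintro hC f g ⟨c, hc, hf⟩ hg
    by_contra! hlt
    obtain ⟨lam, hlow, hup⟩ := EReal.lt_iff_exists_real_btwn.1 hlt
    obtain ⟨ψ, hψ, hψlt⟩ := extraction_of_frequently_atTop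
      (frequently_lt_of_liminf_lt (by isBoundedDefault) hlow)
    obtain ⟨⟨_, hle⟩, _⟩ := hC lam c hc (fun n => f (ψ n))
      (fun n => ⟨⟨(f (ψ n)).2, (hψlt n).le⟩, hf _⟩) g
      (fun ε hε => (hg ε hε).comp hψ.tendsto_atTop)
    exact hup.not_ge hle

end Theorems

end EquicontKothe
end
end

section
/- Suppose μ is non-atomic and K ⊆ L⁰(μ) is absolutely convex, closed in probability, and bounded in probability. Then span(K) ≠ L⁰(μ). -/
open MeasureTheory Filter Topology Pointwise

noncomputable section

namespace EquicontKothe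

variable {Ω : Type*} [MeasurableSpace Ω] (μ : Measure Ω) [IsProbabilityMeasure μ]

/-- A non-atomic probability space admits a measurable map to `ℕ` all of whose fibres have
positive measure. -/
theorem Nonatomic.exists_measurable_nat {Ω : Type*} [MeasurableSpace Ω] {μ : Measure Ω}
    [IsProbabilityMeasure μ] (hna : Nonatomic μ) :
    ∃ N : Ω → ℕ, Measurable N ∧ ∀ n, 0 < μ (N ⁻¹' {n}) := by
  classical
  choose! B hBm hBsub hBpos hBlt using hna
  let A : ℕ → Set Ω := fun n => B^[n] Set.univ
  have hsucc (n : ℕ) : A (n + 1) = B (A n) := Function.iterate_succ_apply' B n Set.univ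
  have hA (n : ℕ) : MeasurableSet (A n) ∧ 0 < μ (A n) := by
    induction n with
    | zero => exact ⟨MeasurableSet.univ, by simp [A]⟩
    | succ n ih => rw [hsucc]; exact ⟨hBm _ ih.1 ih.2, hBpos _ ih.1 ih.2⟩
  have hanti : Antitone A := antitone_nat_of_succ_le fun n => by
    rw [hsucc]; exact hBsub _ (hA n).1 (hA n).2
  have hex (ω : Ω) : ∃ n, ω ∉ A (n + 1) ∨ ω ∈ ⋂ k, A k := by
    by_cases h : ω ∈ ⋂ k, A k
    · exact ⟨0, Or.inr h⟩
    · obtain ⟨k, hk⟩ := not_forall.1 (mt Set.mem_iInter.2 h)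
      exact ⟨k, Or.inl fun h' => hk (hanti k.le_succ h')⟩
  refine ⟨fun ω => Nat.find (hex ω), measurable_find hex fun k => ?_, fun n => ?_⟩
  · exact (hA (k + 1)).1.compl.union (MeasurableSet.iInter fun k => (hA k).1)
  · have hpos : 0 < μ (A n \ A (n + 1)) := by
      refine lt_of_lt_of_le (tsub_pos_of_lt ?_) le_measure_sdiff
      rw [hsucc]
      exact hBlt _ (hA n).1 (hA n).2
    refine hpos.trans_le (measure_mono fun ω hω => ?_)
    rw [Set.mem_preimage, Set.mem_singleton_iff, Nat.find_eq_iff]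
    refine ⟨Or.inl hω.2, fun k hk h => ?_⟩
    rcases h with h | h
    · exact h (hanti hk hω.1)
    · exact hω.2 (Set.mem_iInter.1 h _)

/-- Every element of the span of a nonempty absolutely convex set is absorbed by that set. -/
theorem exists_pos_smul_mem_of_mem_span {E : Type*} [AddCommGroup E] [Module ℝ E] {K : Set E}
    (hne : K.Nonempty) (hconv : Convex ℝ K) (hbal : Balanced ℝ K) {f : E}
    (hf : f ∈ Submodule.span ℝ K) : ∃ c : ℝ, 0 < c ∧ c • f ∈ K := by
  have hshrink {c d : ℝ} {g : E} (hg : c • g ∈ K) (hc : 0 < c) (hd : 0 ≤ d) (hdc : d ≤ c) :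
      d • g ∈ K := by
    have h := hbal.smul_mem (a := d / c)
      (by rw [Real.norm_eq_abs, abs_of_nonneg (by positivity)]; exact (div_le_one hc).2 hdc) hg
    rwa [smul_smul, div_mul_cancel₀ _ hc.ne'] at h
  induction hf using Submodule.span_induction with
  | mem x hx => exact ⟨1, one_pos, by simpa using hx⟩
  | zero => exact ⟨1, one_pos, by simpa using hbal.zero_mem hne⟩
  | add x y _ _ hx hy =>
    obtain ⟨c, hc, hcx⟩ := hx
    obtain ⟨d, hd, hdy⟩ := hy
    have he : 0 < min c d := lt_min hc hd
    refine ⟨min c d / 2, by positivity, ?_⟩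
    have h := hconv (hshrink hcx hc he.le (min_le_left c d))
      (hshrink hdy hd he.le (min_le_right c d)) (a := 1 / 2) (b := 1 / 2)
      (by norm_num) (by norm_num) (by norm_num)
    convert h using 1
    module
  | smul a x _ hx =>
    obtain ⟨c, hc, hcx⟩ := hx
    have ha : 0 < |a| + 1 := by positivity
    refine ⟨c / (|a| + 1), by positivity, ?_⟩
    have h := hbal.smul_mem (a := a / (|a| + 1))
      (by rw [Real.norm_eq_abs, abs_div, abs_of_pos ha]; exact (div_le_one ha).2 (by simp)) hcx
    convert h using 1
    rw [smul_smul, smul_smul]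
    congr 1
    ring

/-- Composition with a measurable map `N : Ω → ℕ`, as a linear map from real sequences to
`L⁰(μ)`. -/
def compNat {Ω : Type*} [MeasurableSpace Ω] (μ : Measure Ω) {N : Ω → ℕ} (hN : Measurable N) :
    (ℕ → ℝ) →ₗ[ℝ] Ω →ₘ[μ] ℝ where
  toFun g := AEEqFun.mk (g ∘ N)
    ((measurable_from_nat (f := g)).comp hN).aestronglyMeasurable
  map_add' _ _ := rfl
  map_smul' _ _ := rfl

theorem coeFn_compNat {Ω : Type*} [MeasurableSpace Ω] {μ : Measure Ω} {N : Ω → ℕ}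
    (hN : Measurable N) (g : ℕ → ℝ) : ⇑(compNat μ hN g) =ᵐ[μ] g ∘ N :=
  AEEqFun.coeFn_mk _ _

theorem ClosedInProb.isClosed_preimage_compNat {Ω : Type*} [MeasurableSpace Ω] {μ : Measure Ω}
    [IsProbabilityMeasure μ] {K : Set (Ω →ₘ[μ] ℝ)} (hcl : ClosedInProb μ K) {N : Ω → ℕ}
    (hN : Measurable N) : IsClosed (compNat μ hN ⁻¹' K) := by
  refine IsSeqClosed.isClosed fun x g hx hxg => hcl (fun n => compNat μ hN (x n)) hx _ ?_
  refine tendstoInMeasure_of_tendsto_ae (fun n => (compNat μ hN (x n)).aestronglyMeasurable) ?_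
  filter_upwards [ae_all_iff.2 fun n => coeFn_compNat (μ := μ) hN (x n),
    coeFn_compNat (μ := μ) hN g] with ω h₁ h₂
  simp only [h₁, h₂]
  exact tendsto_pi_nhds.1 hxg (N ω)

/-- A set of sequences with nonempty interior contains every one-coordinate perturbation of some
point, at all but finitely many coordinates. -/
theorem exists_add_single_mem_of_nonempty_interior {S : Set (ℕ → ℝ)}
    (hS : (interior S).Nonempty) :
    ∃ g : ℕ → ℝ, ∃ n : ℕ, ∀ t : ℝ, g + Pi.single n t ∈ S := by
  obtain ⟨g, hg⟩ := hS
  obtain ⟨I, u, hu, hsub⟩ := isOpen_pi_iff.1 isOpen_interior g hg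
  obtain ⟨n, hn⟩ := Infinite.exists_notMem_finset I
  refine ⟨g, n, fun t => interior_subset (hsub fun i hi => ?_)⟩
  have hin : i ≠ n := fun h => hn (h ▸ hi)
  simpa [Pi.single_eq_of_ne hin] using (hu i hi).2

section Theorems

variable (K : Set (Ω →ₘ[μ] ℝ))

theorem stmt10 (hna : Nonatomic μ)
    (hconv : Convex ℝ K) (hbal : Balanced ℝ K)
    (hcl : ClosedInProb μ K) (hbdd : BoundedInProb μ K) :
    EK μ K ≠ ⊤ := by
  intro htop
  have hne : K.Nonempty := by
    rw [Set.nonempty_iff_ne_empty]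
    rintro rfl
    have hmem : (1 : Ω →ₘ[μ] ℝ) ∈ EK μ ∅ := htop ▸ Submodule.mem_top
    have h0 : (1 : Ω →ₘ[μ] ℝ) = 0 := by simpa [EK] using hmem
    have h1 : (1 : Ω → ℝ) =ᵐ[μ] 0 :=
      AEEqFun.coeFn_one.symm.trans ((Filter.EventuallyEq.of_eq (by rw [h0])).trans
        AEEqFun.coeFn_zero)
    obtain ⟨ω, hω⟩ := h1.exists
    simp at hω
  obtain ⟨N, hN, hpos⟩ := hna.exists_measurable_nat
  let T := compNat μ hN
  let F : ℕ → Set (ℕ → ℝ) := fun m => (fun g => ((m : ℝ) + 1)⁻¹ • g) ⁻¹' (T ⁻¹' K)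
  have hFcl (m : ℕ) : IsClosed (F m) :=
    (hcl.isClosed_preimage_compNat hN).preimage (continuous_const_smul _)
  have hFuniv : ⋃ m, F m = Set.univ := by
    refine Set.eq_univ_of_forall fun g => Set.mem_iUnion.2 ?_
    obtain ⟨c, hc, hcg⟩ := exists_pos_smul_mem_of_mem_span hne hconv hbal
      (f := T g) (by change T g ∈ EK μ K; rw [htop]; trivial)
    obtain ⟨m, hm⟩ := exists_nat_one_div_lt hc
    refine ⟨m, ?_⟩
    have hm0 : (0 : ℝ) < ((m : ℝ) + 1)⁻¹ := by positivity
    rw [one_div] at hm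
    have h := hbal.smul_mem (a := ((m : ℝ) + 1)⁻¹ / c)
      (by rw [Real.norm_eq_abs, abs_of_pos (by positivity)]; exact (div_le_one hc).2 hm.le) hcg
    rw [smul_smul, div_mul_cancel₀ _ hc.ne', ← map_smul] at h
    exact h
  obtain ⟨m, hm⟩ := nonempty_interior_of_iUnion_of_closed hFcl hFuniv
  obtain ⟨g, n, hgn⟩ := exists_add_single_mem_of_nonempty_interior hm
  have hm0 : (0 : ℝ) < (m : ℝ) + 1 := by positivity
  have hsingle (t : ℝ) : T (Pi.single n t) ∈ K := by
    have h₁ : T (((m : ℝ) + 1)⁻¹ • (g + Pi.single n (((m : ℝ) + 1) * t))) ∈ K := hgn _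
    have h₂ : T (((m : ℝ) + 1)⁻¹ • (g + Pi.single n (-(((m : ℝ) + 1) * t)))) ∈ K := hgn _
    have h := hconv h₁ (hbal.neg_mem_iff.2 h₂) (a := 1 / 2) (b := 1 / 2)
      (by norm_num) (by norm_num) (by norm_num)
    convert h using 1
    rw [← map_neg, ← map_smul, ← map_smul, ← map_add]
    congr 1
    ext i
    rcases eq_or_ne i n with rfl | hi
    · simp
      field_simp
      ring
    · simp [Pi.single_eq_of_ne hi]
  have hfin : μ (N ⁻¹' {n}) ≠ ⊤ := measure_ne_top _ _
  have hreal : 0 < (μ (N ⁻¹' {n})).toReal := ENNReal.toReal_pos (hpos n).ne' hfin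
  obtain ⟨δ, hδ, hb⟩ := hbdd ((μ (N ⁻¹' {n})).toReal / 2) (by positivity)
  have hle : μ (N ⁻¹' {n}) ≤ μ {ω | δ ≤ |T (Pi.single n δ) ω|} := by
    refine measure_mono_ae ?_
    filter_upwards [coeFn_compNat (μ := μ) hN (Pi.single n δ)] with ω hω hωn
    have hNω : N ω = n := hωn
    change δ ≤ |T (Pi.single n δ) ω|
    rw [show T (Pi.single n δ) ω = δ by simpa [hNω] using hω]
    exact le_abs_self δ
  have hlt := (ENNReal.le_ofReal_iff_toReal_le hfin (by positivity)).1
    (hle.trans (hb _ (hsingle δ)))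
  linarith

end Theorems

end EquicontKothe
end
end
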